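/- For every integer k > n+1 and every z ∈ H_S one has Σ_{λ ∈ ℤ^{n+2}} (−Q₀(z+λ))^{−k} = c_{k,S}^• · Σ_{λ ∈ L₀^# ∩ P_S} Q₀(λ)^{k−(n+2)/2} · e^{2πi(λ,z)₀}, both families being absolutely summable; here Q₀(λ)^{k−(n+2)/2} is the real power of the positive rational number Q₀(λ). -/

import Mathlib

open Matrix Complex

namespace OEis

/-- Extension of an even Gram matrix by a hyperbolic plane:
`[[0,0,1],[0,A,0],[1,0,0]]`. -/
def hyp {m : ℕ} (A : Matrix (Fin m) (Fin m) ℤ) :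
    Matrix (Fin (m + 2)) (Fin (m + 2)) ℤ := fun i j =>
  if hi0 : (i : ℕ) = 0 then (if (j : ℕ) = m + 1 then 1 else 0)
  else if him : (i : ℕ) = m + 1 then (if (j : ℕ) = 0 then 1 else 0)
  else if hj0 : (j : ℕ) = 0 then 0
  else if hjm : (j : ℕ) = m + 1 then 0
  else A ⟨(i : ℕ) - 1, by have := i.isLt; omega⟩ ⟨(j : ℕ) - 1, by have := j.isLt; omega⟩

variable (n : ℕ) (S : Matrix (Fin n) (Fin n) ℤ)

/-- `S₀ = [[0,0,1],[0,-S,0],[1,0,0]]`. -/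
def MatS0 : Matrix (Fin (n + 2)) (Fin (n + 2)) ℤ := hyp (-S)

/-- `S₁ = [[0,0,1],[0,S₀,0],[1,0,0]]`. -/
def MatS1 : Matrix (Fin (n + 4)) (Fin (n + 4)) ℤ := hyp (MatS0 n S)

/-- Bilinear form `uᵀ A v` over a field `K`. -/
def bilin {m : ℕ} (K : Type) [Field K] (A : Matrix (Fin m) (Fin m) ℤ)
    (u v : Fin m → K) : K :=
  u ⬝ᵥ (A.map (Int.cast : ℤ → K)).mulVec v

/-- Quadratic form `Q_A(v) = vᵀAv/2` over a field `K`. -/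
def quadF {m : ℕ} (K : Type) [Field K] (A : Matrix (Fin m) (Fin m) ℤ)
    (v : Fin m → K) : K := bilin K A v v / 2

/-- First component of a vector. -/
def vfirst {m : ℕ} {K : Type} (g : Fin (m + 2) → K) : K := g ⟨0, by omega⟩

/-- Last component of a vector. -/
def vlast {m : ℕ} {K : Type} (g : Fin (m + 2) → K) : K := g ⟨m + 1, by omega⟩

/-- Middle components of a vector. -/
def vmid {m : ℕ} {K : Type} (g : Fin (m + 2) → K) : Fin m → K :=
  fun i => g ⟨(i : ℕ) + 1, by have := i.isLt; omega⟩

/-- gcd of the entries of a rational vector (via numerators). -/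
def ratGcd {m : ℕ} (v : Fin m → ℚ) : ℕ :=
  Finset.gcd Finset.univ fun i => (v i).num.natAbs

/-- `v` has integral entries. -/
def inLat {m : ℕ} (v : Fin m → ℚ) : Prop := ∀ i, ∃ z : ℤ, v i = (z : ℚ)

/-- `g ∈ ℤ^m + c`. -/
def inLatShift {m : ℕ} (c g : Fin m → ℚ) : Prop := ∀ i, ∃ z : ℤ, g i - c i = (z : ℚ)

/-- Membership in the dual lattice `A⁻¹ℤ^m`, i.e. `Av` is integral. -/
def inDual {m : ℕ} (A : Matrix (Fin m) (Fin m) ℤ) (v : Fin m → ℚ) : Prop :=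
  ∀ i, ∃ z : ℤ, ((A.map (Int.cast : ℤ → ℚ)).mulVec v) i = (z : ℚ)

/-- The positive cone `P_S`. -/
def PosCone : Set (Fin (n + 2) → ℝ) :=
  {y | 0 < quadF ℝ (MatS0 n S) y ∧ 0 < y ⟨0, by omega⟩}

/-- The tube domain `H_S`. -/
def HS : Set (Fin (n + 2) → ℂ) :=
  {z | (fun i => (z i).im) ∈ PosCone n S}

/-- Automorphy factor attached to a vector:
`j(g,z) = -γ Q₀(z) + (d,z)₀ + δ` for `g = (δ,dᵀ,γ)ᵀ`. -/
noncomputable def jay (g : Fin (n + 4) → ℚ) (z : Fin (n + 2) → ℂ) : ℂ :=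
  -((vlast g : ℚ) : ℂ) * quadF ℂ (MatS0 n S) z
    + bilin ℂ (MatS0 n S) (fun i => ((vmid g i : ℚ) : ℂ)) z
    + ((vfirst g : ℚ) : ℂ)

/-- The index set of the Eisenstein series attached to a cusp `c`:
`{g ∈ L₁ + c : Q₁(g) = 0, gcd(S₁g) = 1}`. -/
def cuspSet (c : Fin (n + 4) → ℚ) : Set (Fin (n + 4) → ℚ) :=
  {g | inLatShift c g ∧ quadF ℚ (MatS1 n S) g = 0 ∧
    ratGcd (((MatS1 n S).map (Int.cast : ℤ → ℚ)).mulVec g) = 1}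

/-- The standard-form cusp vector `(1, 0, 𝔠ᵀ, 0, Q(𝔠))ᵀ`. -/
def stdCuspVec (fc : Fin n → ℚ) : Fin (n + 4) → ℚ := fun i =>
  if h0 : (i : ℕ) = 0 then 1
  else if h3 : (i : ℕ) = n + 3 then quadF ℚ S fc
  else if h12 : (i : ℕ) = 1 ∨ (i : ℕ) = n + 2 then 0
  else fc ⟨(i : ℕ) - 2, by have := i.isLt; omega⟩

/-- `c` is a standard-form cusp. -/
def IsStdCusp (c : Fin (n + 4) → ℚ) : Prop :=
  ∃ fc : Fin n → ℚ, inDual S fc ∧ (∃ z : ℤ, quadF ℚ S fc = (z : ℚ)) ∧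
    c = stdCuspVec n S fc

/-- The real orthogonal group of `A`. -/
def OSet {m : ℕ} (A : Matrix (Fin m) (Fin m) ℤ) : Set (Matrix (Fin m) (Fin m) ℝ) :=
  {M | Mᵀ * A.map (Int.cast : ℤ → ℝ) * M = A.map (Int.cast : ℤ → ℝ)}

/-- Connected component of the identity in the real orthogonal group. -/
def OPlus {m : ℕ} (A : Matrix (Fin m) (Fin m) ℤ) : Set (Matrix (Fin m) (Fin m) ℝ) :=
  connectedComponentIn (OSet A) 1

/-- `Γ_S`: integral matrices in `O⁺(S₁;ℝ)`. -/
def GammaS : Set (Matrix (Fin (n + 4)) (Fin (n + 4)) ℝ) :=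
  {M | M ∈ OPlus (MatS1 n S) ∧ ∀ i j, ∃ z : ℤ, M i j = (z : ℝ)}

/-- The discriminant kernel `Γ̃_S`. -/
def GammaTilde : Set (Matrix (Fin (n + 4)) (Fin (n + 4)) ℝ) :=
  {M | M ∈ GammaS n S ∧
    ∃ X : Matrix (Fin (n + 4)) (Fin (n + 4)) ℤ,
      M = 1 + (X * MatS1 n S).map (Int.cast : ℤ → ℝ)}

/-- Automorphy factor of a matrix: `j(M,z) = -γ Q₀(z) + (d,z)₀ + δ`
where `(γ, dᵀS₀, δ)` is the bottom row of `M`. -/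
noncomputable def jayM (M : Matrix (Fin (n + 4)) (Fin (n + 4)) ℝ)
    (z : Fin (n + 2) → ℂ) : ℂ :=
  -((M ⟨n + 3, by omega⟩ ⟨0, by omega⟩ : ℝ) : ℂ) * quadF ℂ (MatS0 n S) z
    + ∑ i : Fin (n + 2),
        ((M ⟨n + 3, by omega⟩ ⟨(i : ℕ) + 1, by have := i.isLt; omega⟩ : ℝ) : ℂ) * z i
    + ((M ⟨n + 3, by omega⟩ ⟨n + 3, by omega⟩ : ℝ) : ℂ)

/-- The action `M⟨z⟩ = (-Q₀(z)·b + Kz + c')·j(M,z)⁻¹`. -/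
noncomputable def actM (M : Matrix (Fin (n + 4)) (Fin (n + 4)) ℝ)
    (z : Fin (n + 2) → ℂ) : Fin (n + 2) → ℂ := fun i =>
  (-(quadF ℂ (MatS0 n S) z) *
      ((M ⟨(i : ℕ) + 1, by have := i.isLt; omega⟩ ⟨0, by omega⟩ : ℝ) : ℂ)
    + ∑ j : Fin (n + 2),
        ((M ⟨(i : ℕ) + 1, by have := i.isLt; omega⟩
            ⟨(j : ℕ) + 1, by have := j.isLt; omega⟩ : ℝ) : ℂ) * z j
    + ((M ⟨(i : ℕ) + 1, by have := i.isLt; omega⟩ ⟨n + 3, by omega⟩ : ℝ) : ℂ))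
  * (jayM n S M z)⁻¹

/-- The integral vector `(−Q₀(d)/γ, dᵀ, γ)ᵀ` built from `d` and `γ`. -/
def gExt (d : Fin (n + 2) → ℕ) (γ : ℕ) : Fin (n + 4) → ℚ := fun i =>
  if h0 : (i : ℕ) = 0 then -(quadF ℚ (MatS0 n S) fun j => (d j : ℚ)) / γ
  else if h3 : (i : ℕ) = n + 3 then (γ : ℚ)
  else (d ⟨(i : ℕ) - 1, by have := i.isLt; omega⟩ : ℚ)

open scoped Classical in
/-- The Dirichlet coefficient `a(λ,γ)`. -/
noncomputable def aCoef (lam : Fin (n + 2) → ℚ) (γ : ℕ) : ℂ :=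
  ∑ d ∈ Fintype.piFinset fun _ : Fin (n + 2) => Finset.range γ,
    if (∃ e : ℤ, quadF ℚ (MatS0 n S) (fun j => (d j : ℚ)) = (γ : ℚ) * e) ∧
        ratGcd (((MatS1 n S).map (Int.cast : ℤ → ℚ)).mulVec (gExt n S d γ)) = 1 then
      Complex.exp (2 * Real.pi * Complex.I *
        ((bilin ℚ (MatS0 n S) lam (fun j => (d j : ℚ)) / γ : ℚ) : ℂ))
    else 0

/-- The convolution `b(λ,γ) = Σ_{δ∣γ} a(λ,δ)`. -/
noncomputable def bCoef (lam : Fin (n + 2) → ℚ) (γ : ℕ) : ℂ :=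
  ∑ δ ∈ γ.divisors, aCoef n S lam δ

/-- The order/level of a rational vector: least `N ≥ 1` with `Nv` integral. -/
noncomputable def ordv {m : ℕ} (v : Fin m → ℚ) : ℕ :=
  sInf {N : ℕ | 0 < N ∧ ∀ i, ∃ z : ℤ, (N : ℚ) * v i = (z : ℚ)}

/-- `S` is `p`-maximal. -/
def pMaximal (p : ℕ) : Prop :=
  ∀ v : Fin n → ℚ, inDual S v → (∃ z : ℤ, quadF ℚ S v = (z : ℚ)) → ¬ p ∣ ordv v

/-- The vector `(l, μᵀ, m)ᵀ ∈ ℚ^{n+2}`. -/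
def asmVec (l : ℚ) (μ : Fin n → ℚ) (m : ℚ) : Fin (n + 2) → ℚ := fun i =>
  if h0 : (i : ℕ) = 0 then l
  else if h1 : (i : ℕ) = n + 1 then m
  else μ ⟨(i : ℕ) - 1, by have := i.isLt; omega⟩

open scoped Classical in
/-- The representation number `N(λ, p^ν, p^t)`. -/
noncomputable def Ncount (lam : Fin (n + 2) → ℚ) (p νl ν t : ℕ) : ℕ :=
  ((Fintype.piFinset fun _ : Fin n => Finset.range (p ^ ν)).filter fun v =>
    (∃ e : ℤ, quadF ℚ S (fun i => (v i : ℚ)) = (p : ℚ) ^ (t : ℕ) * e) ∧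
    (∃ e : ℤ, (p : ℚ) ^ ((νl : ℤ) - (t : ℤ)) * quadF ℚ S (fun i => (v i : ℚ))
        - bilin ℚ S (fun i => (v i : ℚ)) (vmid lam)
        + (p : ℚ) ^ ((t : ℤ) - (νl : ℤ)) * lam ⟨0, by omega⟩ * lam ⟨n + 1, by omega⟩
      = (p : ℚ) ^ (ν : ℕ) * e)).card

/-- `N*(λ,p^ν) = Σ_{t=0}^{min(ν,ν_λ)} N(λ,p^ν,p^t)`. -/
noncomputable def Nstar (lam : Fin (n + 2) → ℚ) (p νl ν : ℕ) : ℕ :=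
  ∑ t ∈ Finset.range (min ν νl + 1), Ncount n S lam p νl ν t

/-- Kloosterman sum `K(α,β;γ)` (with `β` allowed rational;
in all uses `β` is an integer). -/
noncomputable def kloos (α : ℤ) (β : ℚ) (γ : ℕ) : ℂ :=
  ∑ j ∈ Finset.range γ,
    if Nat.Coprime j γ then
      Complex.exp (2 * Real.pi * Complex.I *
        ((((α : ℚ) * j + β * ((((j : ZMod γ)⁻¹).val : ℕ) : ℚ)) / γ : ℚ) : ℂ))
    else 0

/-- `q ≡ 0 (mod p^k)` in `ℤ_p`, for a rational `q`. -/
def pCong (p k : ℕ) (q : ℚ) : Prop :=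
  q = 0 ∨ (k : ℤ) ≤ padicValRat p q

/-- The constant `c_{k,S}^• = (2π)^{2k-n/2}/(√(det S)·Γ(k)·Γ(k-n/2))`. -/
noncomputable def ckS (k : ℕ) : ℝ :=
  (2 * Real.pi) ^ ((2 * k : ℝ) - n / 2) /
    (Real.sqrt ((S.det : ℤ) : ℝ) * Real.Gamma (k : ℝ) * Real.Gamma ((k : ℝ) - n / 2))

end OEis

open OEis

section Poisson

open MeasureTheory Set

noncomputable local instance : MeasureSpace UnitAddCircle := ⟨AddCircle.haarAddCircle⟩

local instance : IsProbabilityMeasure (volume : Measure UnitAddCircle) :=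
  inferInstanceAs (IsProbabilityMeasure AddCircle.haarAddCircle)

variable {ι : Type*}

/-- The half-open unit box with lower corner `m`. -/
def unitBox (m : ι → ℤ) : Set (ι → ℝ) := {x | ∀ i, x i ∈ Ioc (m i : ℝ) (m i + 1)}

lemma measurableSet_unitBox [Finite ι] (m : ι → ℤ) : MeasurableSet (unitBox m) :=
  MeasurableSet.univ_pi' fun _ => measurableSet_Ioc

lemma mem_unitBox_iff (m : ι → ℤ) (x : ι → ℝ) :
    x ∈ unitBox m ↔ m = fun i => ⌈x i⌉ - 1 := by
  rw [funext_iff]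
  refine forall_congr' fun i => ?_
  rw [eq_sub_iff_add_eq, eq_comm, Int.ceil_eq_iff]
  simp

lemma iUnion_unitBox : ⋃ m : ι → ℤ, unitBox m = univ :=
  eq_univ_of_forall fun x => mem_iUnion.2 ⟨_, (mem_unitBox_iff _ x).2 rfl⟩

lemma pairwise_disjoint_unitBox :
    Pairwise (Function.onFun Disjoint (unitBox : (ι → ℤ) → Set (ι → ℝ))) := by
  intro m m' h
  refine Set.disjoint_left.2 fun x hx hx' => h ?_
  rw [mem_unitBox_iff] at hx hx'
  rw [hx, hx']

/-- The sum of the translates of `g` by integral vectors, as a function on the torus. -/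
noncomputable def periodize (g : (ι → ℝ) → ℂ) (t : UnitAddTorus ι) : ℂ :=
  ∑' m : ι → ℤ, g ((fun i => (AddCircle.equivIoc 1 0 (t i) : ℝ)) + fun i => (m i : ℝ))

lemma periodize_coe (g : (ι → ℝ) → ℂ) (x : ι → ℝ) :
    periodize g (fun i => (x i : UnitAddCircle)) =
      ∑' m : ι → ℤ, g (x + fun i => (m i : ℝ)) := by
  have h : ∀ i, ∃ k : ℤ, x i + k = (AddCircle.equivIoc 1 0 (x i : UnitAddCircle) : ℝ) := by
    intro i
    have h1 : (((AddCircle.equivIoc 1 0 (x i : UnitAddCircle) : ℝ)) : UnitAddCircle) = x i :=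
      (AddCircle.equivIoc 1 0).symm_apply_apply _
    rw [eq_comm, ← sub_eq_zero, ← AddCircle.coe_sub, AddCircle.coe_eq_zero_iff] at h1
    obtain ⟨k, hk⟩ := h1
    refine ⟨-k, ?_⟩
    simp only [zsmul_eq_mul, mul_one] at hk
    push_cast
    linarith
  choose k hk using h
  unfold periodize
  rw [← (Equiv.addLeft k).tsum_eq (fun m : ι → ℤ => g (x + fun i => (m i : ℝ)))]
  refine tsum_congr fun m => congrArg g ?_
  ext i
  simp only [Pi.add_apply, ← hk, Equiv.coe_addLeft, Int.cast_add]
  ring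

variable [Fintype ι]

lemma norm_le_one_of_mem_unitBox {x : ι → ℝ} (hx : x ∈ unitBox (0 : ι → ℤ)) : ‖x‖ ≤ 1 := by
  refine (pi_norm_le_iff_of_nonneg zero_le_one).2 fun i => ?_
  have := hx i
  simp only [Pi.zero_apply, Int.cast_zero, zero_add, mem_Ioc] at this
  rw [Real.norm_eq_abs, abs_of_pos this.1]
  exact this.2

lemma setIntegral_unitBox {E : Type*} [NormedAddCommGroup E] [NormedSpace ℝ E]
    (F : (ι → ℝ) → E) (m : ι → ℤ) :
    ∫ x in unitBox m, F x = ∫ x in unitBox 0, F (x + fun i => (m i : ℝ)) := by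
  have h := (measurePreserving_add_right volume
    (fun i => (m i : ℝ) : ι → ℝ)).setIntegral_preimage_emb
    (MeasurableEquiv.addRight (fun i => (m i : ℝ) : ι → ℝ)).measurableEmbedding F (unitBox m)
  rw [← h]
  congr 2
  ext x
  simp only [unitBox, mem_ofPred_eq, mem_preimage, Pi.add_apply, Pi.zero_apply, Int.cast_zero,
    mem_Ioc]
  refine forall_congr' fun i => ?_
  constructor <;> rintro ⟨h1, h2⟩ <;> constructor <;> linarith

lemma integrableOn_unitBox {E : Type*} [NormedAddCommGroup E]
    {F : (ι → ℝ) → E} (hF : Integrable F) (m : ι → ℤ) :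
    IntegrableOn (fun x => F (x + fun i => (m i : ℝ))) (unitBox 0) :=
  (hF.comp_add_right _).integrableOn

lemma hasSum_setIntegral_unitBox {E : Type*} [NormedAddCommGroup E] [NormedSpace ℝ E]
    {F : (ι → ℝ) → E} (hF : Integrable F) :
    HasSum (fun m : ι → ℤ => ∫ x in unitBox 0, F (x + fun i => (m i : ℝ))) (∫ x, F x) := by
  have := hasSum_integral_iUnion (μ := volume) (f := F) (s := (unitBox : (ι → ℤ) → Set (ι → ℝ)))
    measurableSet_unitBox pairwise_disjoint_unitBox hF.integrableOn
  simpa only [setIntegral_unitBox F, iUnion_unitBox, Measure.restrict_univ] using this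

/-- A polynomial weight which is integrable and summable over the lattice. -/
noncomputable def polyWeight (x : ι → ℝ) : ℝ := (1 + ‖x‖) ^ (-((Fintype.card ι : ℝ) + 1))

lemma polyWeight_pos (x : ι → ℝ) : 0 < polyWeight x := by
  unfold polyWeight; positivity

lemma integrable_polyWeight : Integrable (polyWeight : (ι → ℝ) → ℝ) := by
  unfold polyWeight
  exact integrable_one_add_norm (by simp)

lemma polyWeight_le_mul {R : ℝ} (x y : ι → ℝ) (hy : ‖y‖ ≤ R) :
    polyWeight x ≤ (1 + R) ^ ((Fintype.card ι : ℝ) + 1) * polyWeight (y + x) := by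
  have hR : 0 ≤ R := (norm_nonneg y).trans hy
  unfold polyWeight
  rw [Real.rpow_neg (by positivity), Real.rpow_neg (by positivity), ← div_eq_mul_inv,
    le_div_iff₀ (by positivity), inv_mul_le_iff₀ (by positivity),
    ← Real.mul_rpow (by positivity) (by positivity)]
  refine Real.rpow_le_rpow (by positivity) ?_ (by positivity)
  have h := norm_sub_norm_le (y + x) y
  have h2 : ‖y + x‖ ≤ ‖y‖ + ‖x‖ := norm_add_le _ _
  nlinarith [norm_nonneg x]

lemma polyWeight_add_le {R : ℝ} (x y : ι → ℝ) (hy : ‖y‖ ≤ R) :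
    polyWeight (y + x) ≤ (1 + R) ^ ((Fintype.card ι : ℝ) + 1) * polyWeight x := by
  have := polyWeight_le_mul (y + x) (-y) ((norm_neg y).trans_le hy)
  rwa [neg_add_cancel_left] at this

lemma summable_polyWeight :
    Summable fun m : ι → ℤ => polyWeight (fun i => (m i : ℝ)) := by
  have h := (hasSum_setIntegral_unitBox (ι := ι) integrable_polyWeight).summable.mul_left
    ((1 + 1 : ℝ) ^ ((Fintype.card ι : ℝ) + 1))
  refine h.of_nonneg_of_le (fun m => (polyWeight_pos _).le) fun m => ?_
  have hvol : volume.real (unitBox (0 : ι → ℤ)) = 1 := by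
    have : unitBox (0 : ι → ℤ) = univ.pi fun _ : ι => Ioc (0 : ℝ) 1 := by
      ext x; simp [unitBox]
    rw [this, Measure.real, Real.volume_pi_Ioc]
    simp
  have hfin : volume (unitBox (0 : ι → ℤ)) ≠ ⊤ := fun h => by
    simp [Measure.real, h] at hvol
  rw [← integral_const_mul]
  calc polyWeight (fun i => (m i : ℝ))
      = ∫ x in unitBox (0 : ι → ℤ), polyWeight (fun i => (m i : ℝ)) := by
        rw [setIntegral_const, hvol, one_smul]
    _ ≤ _ := by
        refine setIntegral_mono_on (integrableOn_const hfin)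
          ((integrableOn_unitBox integrable_polyWeight m).const_mul _)
          (measurableSet_unitBox _) fun x hx => ?_
        exact polyWeight_le_mul _ _ (norm_le_one_of_mem_unitBox hx)

variable {g : (ι → ℝ) → ℂ} {C : ℝ}

lemma summable_norm_lattice (hg : ∀ x, ‖g x‖ ≤ C * polyWeight x) (x : ι → ℝ) :
    Summable fun m : ι → ℤ => ‖g (x + fun i => (m i : ℝ))‖ := by
  have hC : 0 ≤ C := nonneg_of_mul_nonneg_left ((norm_nonneg _).trans (hg 0)) (polyWeight_pos 0)
  refine (summable_polyWeight.mul_left (C * (1 + ‖x‖) ^ ((Fintype.card ι : ℝ) + 1))).of_nonneg_of_le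
    (fun _ => norm_nonneg _) fun m => (hg _).trans ?_
  rw [mul_assoc]
  exact mul_le_mul_of_nonneg_left (polyWeight_add_le _ _ le_rfl) hC

lemma mFourier_coe (n : ι → ℤ) (x : ι → ℝ) :
    UnitAddTorus.mFourier n (fun i => (x i : UnitAddCircle)) =
      cexp (2 * Real.pi * I * ∑ i, (n i : ℂ) * x i) := by
  simp only [UnitAddTorus.mFourier, ContinuousMap.coe_mk]
  rw [Finset.mul_sum, Complex.exp_sum]
  refine Finset.prod_congr rfl fun i _ => ?_
  rw [fourier_coe_apply]
  congr 1
  push_cast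
  ring

/-- The Fourier transform of `g` at the integral vector `n`. -/
noncomputable def latticeFourier (g : (ι → ℝ) → ℂ) (n : ι → ℤ) : ℂ :=
  ∫ x, cexp (-(2 * Real.pi * I * ∑ i, (n i : ℂ) * x i)) * g x

lemma integrable_of_polyWeight (hm : Measurable g) (hg : ∀ x, ‖g x‖ ≤ C * polyWeight x) :
    Integrable g :=
  (integrable_polyWeight.const_mul C).mono' hm.aestronglyMeasurable (ae_of_all _ hg)

lemma mFourierCoeff_periodize (hm : Measurable g) (hg : ∀ x, ‖g x‖ ≤ C * polyWeight x)
    (n : ι → ℤ) : UnitAddTorus.mFourierCoeff (periodize g) n = latticeFourier g n := by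
  set F : (ι → ℝ) → ℂ := fun x => cexp (-(2 * Real.pi * I * ∑ i, (n i : ℂ) * x i)) * g x with hF
  have hFn : ∀ x, ‖F x‖ = ‖g x‖ := by
    intro x
    rw [hF]
    simp only [norm_mul, Complex.norm_exp]
    rw [show -(2 * Real.pi * I * ∑ i, (n i : ℂ) * x i) =
      ((-(2 * Real.pi * ∑ i, (n i : ℝ) * x i) : ℝ) : ℂ) * I by push_cast; ring]
    simp
  have hFm : Measurable F := by
    rw [hF]
    exact (by fun_prop : Measurable fun x : ι → ℝ =>
      cexp (-(2 * Real.pi * I * ∑ i, (n i : ℂ) * x i))).mul hm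
  have hFi : Integrable F := integrable_of_polyWeight hFm (C := C) fun x => by
    rw [hFn]; exact hg x
  rw [UnitAddTorus.mFourierCoeff_eq_integral _ _ 0]
  have hbox : {x : ι → ℝ | ∀ i, x i ∈ Ioc ((0 : ι → ℝ) i) ((0 : ι → ℝ) i + 1)} =
      unitBox (0 : ι → ℤ) := by
    ext x; simp [unitBox]
  rw [hbox]
  have hper : ∀ x : ι → ℝ, UnitAddTorus.mFourier (-n) (fun i => (x i : UnitAddCircle)) •
      periodize g (fun i => (x i : UnitAddCircle)) =
      ∑' m : ι → ℤ, F (x + fun i => (m i : ℝ)) := by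
    intro x
    rw [periodize_coe, smul_eq_mul, ← tsum_mul_left]
    refine tsum_congr fun m => ?_
    rw [hF, mFourier_coe]
    congr 1
    rw [Complex.exp_eq_exp_iff_exists_int]
    refine ⟨∑ i, n i * m i, ?_⟩
    simp only [Pi.neg_apply, Pi.add_apply]
    push_cast
    simp only [mul_add, Finset.sum_add_distrib, neg_mul, Finset.sum_neg_distrib]
    ring
  simp_rw [hper]
  rw [← (hasSum_integral_of_summable_integral_norm (integrableOn_unitBox hFi)
    (hasSum_setIntegral_unitBox hFi.norm).summable).tsum_eq]
  exact (hasSum_setIntegral_unitBox hFi).tsum_eq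

lemma norm_periodize_le (hg : ∀ x, ‖g x‖ ≤ C * polyWeight x) :
    ∃ M, ∀ t, ‖periodize g t‖ ≤ M := by
  have hC : 0 ≤ C := nonneg_of_mul_nonneg_left ((norm_nonneg _).trans (hg 0)) (polyWeight_pos 0)
  refine ⟨∑' m : ι → ℤ, (C * (1 + 1) ^ ((Fintype.card ι : ℝ) + 1)) *
    polyWeight (fun i => (m i : ℝ)), fun t => ?_⟩
  unfold periodize
  refine tsum_of_norm_bounded (summable_polyWeight.mul_left _).hasSum fun m => (hg _).trans ?_
  rw [mul_assoc]
  refine mul_le_mul_of_nonneg_left (polyWeight_add_le _ _ (norm_le_one_of_mem_unitBox ?_)) hC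
  intro i
  simpa using (AddCircle.equivIoc (1 : ℝ) 0 (t i)).2

lemma measurable_periodize (hm : Measurable g) (hg : ∀ x, ‖g x‖ ≤ C * polyWeight x) :
    Measurable (periodize g) := by
  have hrep : Measurable fun (t : UnitAddTorus ι) (i : ι) =>
      (AddCircle.equivIoc 1 0 (t i) : ℝ) :=
    measurable_pi_lambda _ fun i => measurable_subtype_coe.comp
      ((AddCircle.measurableEquivIoc 1 0).measurable.comp (measurable_pi_apply i))
  refine measurable_of_tendsto_metrizable'
    (f := fun (s : Finset (ι → ℤ)) (t : UnitAddTorus ι) =>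
      ∑ m ∈ s, g ((fun i => (AddCircle.equivIoc 1 0 (t i) : ℝ)) + fun i => (m i : ℝ)))
    Filter.atTop (fun s => ?_) (tendsto_pi_nhds.2 fun t => ?_)
  · exact Finset.measurable_fun_sum _ fun m _ => hm.comp (hrep.add_const _)
  · exact (summable_norm_lattice hg _).of_norm.hasSum

lemma continuous_periodize (hc : Continuous g) (hg : ∀ x, ‖g x‖ ≤ C * polyWeight x) :
    Continuous (periodize g) := by
  have hC : 0 ≤ C := nonneg_of_mul_nonneg_left ((norm_nonneg _).trans (hg 0)) (polyWeight_pos 0)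
  have hq : IsOpenQuotientMap (Pi.map fun (_ : ι) (x : ℝ) => (x : UnitAddCircle)) :=
    IsOpenQuotientMap.piMap fun _ => QuotientAddGroup.isOpenQuotientMap_mk
  rw [hq.isQuotientMap.continuous_iff]
  have : periodize g ∘ (Pi.map fun (_ : ι) (x : ℝ) => (x : UnitAddCircle)) =
      fun x => ∑' m : ι → ℤ, g (x + fun i => (m i : ℝ)) := by
    ext x
    exact periodize_coe g x
  rw [this, continuous_iff_continuousAt]
  intro x
  have hball : Metric.ball x 1 ∈ nhds x := Metric.ball_mem_nhds _ one_pos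
  refine ContinuousOn.continuousAt ?_ hball
  refine continuousOn_tsum (u := fun m : ι → ℤ => (C * (1 + (‖x‖ + 1)) ^
    ((Fintype.card ι : ℝ) + 1)) * polyWeight (fun i => (m i : ℝ)))
    (fun m => (hc.comp (continuous_add_const _)).continuousOn)
    (summable_polyWeight.mul_left _) fun m y hy => (hg _).trans ?_
  rw [mul_assoc]
  refine mul_le_mul_of_nonneg_left (polyWeight_add_le _ _ ?_) hC
  rw [Metric.mem_ball, dist_eq_norm] at hy
  linarith [norm_le_norm_add_norm_sub' y x]

/-- Bessel's inequality for the periodization of a rapidly decaying function. -/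
theorem summable_sq_latticeFourier (hm : Measurable g) (hg : ∀ x, ‖g x‖ ≤ C * polyWeight x) :
    Summable fun n : ι → ℤ => ‖latticeFourier g n‖ ^ 2 := by
  obtain ⟨M, hM⟩ := norm_periodize_le hg
  have hL : MemLp (periodize g) 2 (volume : Measure (UnitAddTorus ι)) :=
    MemLp.of_bound (measurable_periodize hm hg).aestronglyMeasurable M (ae_of_all _ hM)
  refine (UnitAddTorus.hasSum_sq_mFourierCoeff hL.toLp).summable.congr fun n => ?_
  rw [← mFourierCoeff_periodize hm hg n]
  congr 2
  refine integral_congr_ae ?_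
  filter_upwards [hL.coeFn_toLp] with t ht
  rw [ht]

/-- Poisson summation for a continuous rapidly decaying function with summable Fourier transform. -/
theorem tsum_eq_tsum_latticeFourier (hc : Continuous g) (hg : ∀ x, ‖g x‖ ≤ C * polyWeight x)
    (hs : Summable (latticeFourier g)) :
    ∑' m : ι → ℤ, g (fun i => (m i : ℝ)) = ∑' n, latticeFourier g n := by
  have hco : UnitAddTorus.mFourierCoeff (periodize g) = latticeFourier g :=
    funext (mFourierCoeff_periodize hc.measurable hg)
  have := UnitAddTorus.hasSum_mFourier_series_apply_of_summable
    (f := ⟨periodize g, continuous_periodize hc hg⟩) (by simpa only [ContinuousMap.coe_mk, hco])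
    (fun i => ((0 : ℝ) : UnitAddCircle))
  simp only [ContinuousMap.coe_mk, hco, mFourier_coe] at this
  have h0 := periodize_coe g 0
  simp only [Pi.zero_apply, zero_add] at h0
  rw [h0] at this
  rw [← this.tsum_eq]
  simp

end Poisson

section Laplace

open MeasureTheory Set

lemma integrableOn_rpow_mul_exp_neg {s b : ℝ} (hs : 0 < s) (hb : 0 < b) :
    IntegrableOn (fun t : ℝ => t ^ (s - 1) * Real.exp (-(b * t))) (Ioi 0) := by
  have := integrableOn_rpow_mul_exp_neg_mul_rpow (s := s - 1) (p := 1) (by linarith) one_pos hb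
  simpa only [Real.rpow_one, neg_mul] using this

/-- The Laplace transform of a power function, at a complex parameter with positive real part. -/
lemma integral_rpow_mul_cexp_neg_mul_Ioi {s : ℝ} (hs : 0 < s) {r : ℂ} (hr : 0 < r.re) :
    ∫ t : ℝ in Ioi 0, ((t ^ (s - 1) : ℝ) : ℂ) * cexp (-(r * t)) =
      (1 / r) ^ (s : ℂ) * (Real.Gamma s : ℂ) := by
  set μ : Measure ℝ := (volume.restrict (Ioi 0)).withDensity fun t => ENNReal.ofReal (t ^ (s - 1))
    with hμ
  have hdens : Measurable fun t : ℝ => ENNReal.ofReal (t ^ (s - 1)) := by fun_prop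
  have hlt : ∀ᵐ t : ℝ ∂(volume.restrict (Ioi 0)), ENNReal.ofReal (t ^ (s - 1)) < ⊤ :=
    ae_of_all _ fun _ => ENNReal.ofReal_lt_top
  have hmgf : ∀ r : ℂ, ProbabilityTheory.complexMGF id μ (-r) =
      ∫ t : ℝ in Ioi 0, ((t ^ (s - 1) : ℝ) : ℂ) * cexp (-(r * t)) := by
    intro r
    unfold ProbabilityTheory.complexMGF
    rw [hμ, integral_withDensity_eq_integral_toReal_smul hdens hlt]
    refine setIntegral_congr_fun measurableSet_Ioi fun t ht => ?_
    have : 0 ≤ t ^ (s - 1) := Real.rpow_nonneg (le_of_lt ht) _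
    simp [ENNReal.toReal_ofReal this]
  have hset : Iio 0 ⊆ ProbabilityTheory.integrableExpSet id μ := by
    intro b hb
    rw [ProbabilityTheory.integrableExpSet, mem_ofPred_eq, hμ,
      integrable_withDensity_iff_integrable_smul' hdens hlt]
    refine (integrableOn_rpow_mul_exp_neg hs (neg_pos.2 hb)).congr_fun (fun t ht => ?_)
      measurableSet_Ioi
    have : 0 ≤ t ^ (s - 1) := Real.rpow_nonneg (le_of_lt ht) _
    simp [ENNReal.toReal_ofReal this]
  have hU : IsOpen {r : ℂ | 0 < r.re} := isOpen_lt continuous_const Complex.continuous_re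
  have hF : AnalyticOnNhd ℂ (fun r => ProbabilityTheory.complexMGF id μ (-r))
      {r : ℂ | 0 < r.re} := by
    refine DifferentiableOn.analyticOnNhd ?_ hU
    refine (ProbabilityTheory.differentiableOn_complexMGF (X := id) (μ := μ)).comp
      differentiable_neg.differentiableOn fun r hr => ?_
    have : (-r).re ∈ Iio (0 : ℝ) := by simpa using hr
    exact interior_mono hset (by rwa [isOpen_Iio.interior_eq])
  have hG : AnalyticOnNhd ℂ (fun r : ℂ => (1 / r) ^ (s : ℂ) * (Real.Gamma s : ℂ))
      {r : ℂ | 0 < r.re} := by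
    refine DifferentiableOn.analyticOnNhd (fun r hr => ?_) hU
    have hr' : 0 < r.re := hr
    have hr0 : r ≠ 0 := fun h => by simp [h] at hr'
    refine DifferentiableAt.differentiableWithinAt (DifferentiableAt.mul_const ?_ _)
    refine DifferentiableAt.cpow_const ?_ ?_
    · exact (differentiableAt_const _).fun_div differentiableAt_id hr0
    · rw [one_div, Complex.mem_slitPlane_iff]
      left
      rw [Complex.inv_re]
      exact div_pos hr' (Complex.normSq_pos.2 hr0)
  have hfreq : ∃ᶠ r in nhdsWithin (1 : ℂ) {1}ᶜ, ProbabilityTheory.complexMGF id μ (-r) =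
      (1 / r) ^ (s : ℂ) * (Real.Gamma s : ℂ) := by
    have ht : Filter.Tendsto (fun x : ℝ => (x : ℂ)) (nhdsWithin 1 {1}ᶜ)
        (nhdsWithin (1 : ℂ) {1}ᶜ) := by
      refine tendsto_nhdsWithin_iff.2 ⟨?_, ?_⟩
      · have := (Complex.continuous_ofReal.tendsto 1).mono_left
          (nhdsWithin_le_nhds (s := ({1}ᶜ : Set ℝ)))
        simpa using this
      · filter_upwards [self_mem_nhdsWithin] with x hx
        simpa using hx
    refine ht.frequently (Filter.Eventually.frequently ?_)
    filter_upwards [nhdsWithin_le_nhds (Ioi_mem_nhds one_pos)] with x hx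
    rw [hmgf, ← Complex.Gamma_ofReal, ← integral_cpow_mul_exp_neg_mul_Ioi (by simpa using hs) hx]
    refine setIntegral_congr_fun measurableSet_Ioi fun t ht => ?_
    rw [Complex.ofReal_cpow (le_of_lt ht)]
    simp
  have := hF.eqOn_of_preconnected_of_frequently_eq hG
    (convex_halfSpace_re_gt 0).isPreconnected (z₀ := 1) (by simp) hfreq hr
  rw [← hmgf]
  exact this

end Laplace

section Gaussian

open MeasureTheory Set

variable {ι : Type*} [Fintype ι]

/-- `Mᵀ w` for a real matrix and a complex vector. -/
noncomputable def transMul (M : Matrix ι ι ℝ) (w : ι → ℂ) (j : ι) : ℂ := ∑ i, (M i j : ℂ) * w i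

lemma sum_mulVec_mul (M : Matrix ι ι ℝ) (x : ι → ℝ) (w : ι → ℂ) :
    ∑ i, ((M *ᵥ x) i : ℂ) * w i = ∑ j, transMul M w j * x j := by
  simp only [transMul, Matrix.mulVec, dotProduct, Complex.ofReal_sum, Complex.ofReal_mul,
    Finset.sum_mul]
  rw [Finset.sum_comm]
  exact Finset.sum_congr rfl fun _ _ => Finset.sum_congr rfl fun _ _ => by ring

variable [DecidableEq ι]

lemma integral_comp_mulVec {E : Type*} [NormedAddCommGroup E] [NormedSpace ℝ E]
    {M : Matrix ι ι ℝ} (hM : M.det ≠ 0) (f : (ι → ℝ) → E) :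
    ∫ v, f v = |M.det| • ∫ x, f (M *ᵥ x) := by
  have hemb : MeasurableEmbedding (fun x : ι → ℝ => M *ᵥ x) := by
    have hunit : IsUnit M.det := isUnit_iff_ne_zero.2 hM
    refine Continuous.measurableEmbedding (by fun_prop) fun x y h => ?_
    have := congrArg (M⁻¹ *ᵥ ·) h
    simpa [Matrix.mulVec_mulVec, Matrix.nonsing_inv_mul _ hunit] using this
  have hmap := Real.map_matrix_volume_pi_eq_smul_volume_pi hM
  rw [← hemb.integral_map (μ := volume) f]
  have : Measure.map (fun x : ι → ℝ => M *ᵥ x) volume =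
      ENNReal.ofReal |(M.det)⁻¹| • (volume : Measure (ι → ℝ)) := by
    rw [← hmap]; rfl
  rw [this, integral_smul_measure, ENNReal.toReal_ofReal (abs_nonneg _), smul_smul, abs_inv,
    mul_inv_cancel₀ (abs_ne_zero.2 hM), one_smul]

/-- The quadratic form `½ |M⁻¹ v|²`. -/
noncomputable def invQuad (M : Matrix ι ι ℝ) (v : ι → ℝ) : ℝ := (∑ i, (M⁻¹ *ᵥ v) i ^ 2) / 2

lemma invQuad_nonneg (M : Matrix ι ι ℝ) (v : ι → ℝ) : 0 ≤ invQuad M v := by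
  unfold invQuad; positivity

lemma continuous_invQuad (M : Matrix ι ι ℝ) : Continuous (invQuad M) := by
  unfold invQuad; fun_prop

lemma invQuad_mulVec {M : Matrix ι ι ℝ} (hM : M.det ≠ 0) (x : ι → ℝ) :
    invQuad M (M *ᵥ x) = (∑ i, x i ^ 2) / 2 := by
  unfold invQuad
  rw [Matrix.mulVec_mulVec, Matrix.nonsing_inv_mul _ (isUnit_iff_ne_zero.2 hM), Matrix.one_mulVec]

lemma integral_cexp_invQuad {M : Matrix ι ι ℝ} (hM : M.det ≠ 0) {β : ℂ} (hβ : 0 < β.re)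
    (w : ι → ℂ) :
    ∫ v : ι → ℝ, cexp (-(β * invQuad M v) + ∑ i, (v i : ℂ) * w i) =
      |M.det| * ((2 * Real.pi / β) ^ (Fintype.card ι / 2 : ℂ) *
        cexp ((∑ j, transMul M w j ^ 2) / (2 * β))) := by
  rw [integral_comp_mulVec hM]
  have h2 : 0 < (β / 2).re := by
    rw [show β / 2 = β / (2 : ℝ) by simp, Complex.div_ofReal_re]
    positivity
  have := GaussianFourier.integral_cexp_neg_mul_sum_add h2 (transMul M w)
  rw [Complex.real_smul]
  congr 1
  convert this using 2
  · ext x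
    rw [invQuad_mulVec hM, sum_mulVec_mul]
    push_cast
    congr 1
    ring
  · congr 1
    field_simp
  · congr 2
    ring

end Gaussian

section ConeKernel

open MeasureTheory Set

lemma im_sq_div_le {w z : ℂ} (hz : 0 < z.im) : (w ^ 2 / z).im ≤ w.im ^ 2 / z.im := by
  have hn : 0 < Complex.normSq z := Complex.normSq_pos.2 fun h => by simp [h] at hz
  rw [Complex.div_im, ← sub_div, div_le_div_iff₀ hn hz, Complex.normSq_apply]
  simp only [pow_two, Complex.mul_im, Complex.mul_re]
  nlinarith [sq_nonneg (w.im * z.re - w.re * z.im)]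

lemma ofReal_mul_cpow {x : ℝ} (hx : 0 < x) {w : ℂ} (hw : w ≠ 0) (s : ℂ) :
    ((x : ℂ) * w) ^ s = (x : ℂ) ^ s * w ^ s := by
  have hx' : (x : ℂ) ≠ 0 := by exact_mod_cast hx.ne'
  rw [Complex.cpow_def_of_ne_zero (mul_ne_zero hx' hw), Complex.cpow_def_of_ne_zero hx',
    Complex.cpow_def_of_ne_zero hw, Complex.log_ofReal_mul hx hw, ← Complex.ofReal_log hx.le,
    add_mul, Complex.exp_add]

variable {ι : Type*} [Fintype ι]

lemma transMul_const_mul (M : Matrix ι ι ℝ) (w : ι → ℂ) (c : ℂ) (j : ι) :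
    transMul M (fun i => c * w i) j = c * transMul M w j := by
  simp only [transMul, Finset.mul_sum]
  exact Finset.sum_congr rfl fun _ _ => by ring

variable {M : Matrix ι ι ℝ} {σ : ℝ} {z₁ z₂ : ℂ} {w : ι → ℂ}

/-- The parameter of the last Gamma integral. -/
noncomputable def coneParam (M : Matrix ι ι ℝ) (z₁ : ℂ) (w : ι → ℂ) (z₂ : ℂ) : ℂ :=
  -(2 * Real.pi * I * (z₁ - (∑ j, transMul M w j ^ 2) / 2 / z₂))

lemma coneParam_re_pos (hz₂ : 0 < z₂.im)
    (hz : (∑ j, (transMul M w j).im ^ 2) / 2 < z₁.im * z₂.im) :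
    0 < (coneParam M z₁ w z₂).re := by
  have h1 : ((∑ j, transMul M w j ^ 2) / 2 / z₂).im < z₁.im := by
    calc ((∑ j, transMul M w j ^ 2) / 2 / z₂).im
        = (∑ j, (transMul M w j ^ 2 / z₂).im) / 2 := by
          rw [div_right_comm, Finset.sum_div, ← Complex.im_sum]
          exact Complex.div_ofReal_im _ 2
      _ ≤ (∑ j, (transMul M w j).im ^ 2 / z₂.im) / 2 := by
          gcongr
          exact im_sq_div_le hz₂
      _ = (∑ j, (transMul M w j).im ^ 2) / 2 / z₂.im := by
          rw [← Finset.sum_div, div_right_comm]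
      _ < z₁.im := by rwa [div_lt_iff₀ hz₂]
  have h2 : (coneParam M z₁ w z₂).re =
      2 * Real.pi * (z₁.im - ((∑ j, transMul M w j ^ 2) / 2 / z₂).im) := by
    unfold coneParam
    simp only [Complex.neg_re, Complex.mul_re, Complex.mul_im, Complex.sub_im, Complex.sub_re,
      Complex.I_re, Complex.I_im, Complex.ofReal_re, Complex.ofReal_im, Complex.re_ofNat,
      Complex.im_ofNat]
    ring
  rw [h2]
  have := Real.pi_pos
  have := sub_pos.2 h1
  positivity

variable [DecidableEq ι]

open scoped Classical in
/-- A power of the form `a b - ½ |M⁻¹ v|²` times an exponential, supported on its positive cone. -/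
noncomputable def coneKernel (M : Matrix ι ι ℝ) (σ : ℝ) (z₁ : ℂ) (w : ι → ℂ) (z₂ : ℂ)
    (a : ℝ) (v : ι → ℝ) (b : ℝ) : ℂ :=
  if 0 < a ∧ invQuad M v < a * b then
    (((a * b - invQuad M v) ^ σ : ℝ) : ℂ) *
      cexp (2 * Real.pi * I * (a * z₁ + ∑ i, (v i : ℂ) * w i + b * z₂))
  else 0

lemma integral_coneKernel_last (hσ : 0 ≤ σ) (hz₂ : 0 < z₂.im) {a : ℝ} (ha : 0 < a)
    (v : ι → ℝ) :
    ∫ b, coneKernel M σ z₁ w z₂ a v b =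
      ((a ^ σ : ℝ) : ℂ) * cexp (2 * Real.pi * I * a * z₁) *
        ((1 / (-(2 * Real.pi * I * z₂))) ^ ((σ + 1 : ℝ) : ℂ) * (Real.Gamma (σ + 1) : ℂ)) *
        cexp (-((-(2 * Real.pi * I * z₂)) / a * invQuad M v) +
          ∑ i, (v i : ℂ) * (2 * Real.pi * I * w i)) := by
  set q := invQuad M v with hq
  have hre : 0 < (-(2 * Real.pi * I * z₂)).re := by
    simp; positivity
  have ha' : (a : ℂ) ≠ 0 := by exact_mod_cast ha.ne'
  rw [← integral_rpow_mul_cexp_neg_mul_Ioi (by linarith : 0 < σ + 1) hre,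
    ← integral_add_right_eq_self _ (q / a), ← integral_const_mul, ← integral_mul_const,
    ← integral_indicator measurableSet_Ioi]
  congr 1
  ext b
  have hab : a * (b + q / a) = a * b + q := by field_simp
  simp only [coneKernel, indicator, mem_Ioi, ← hq, hab, add_sub_cancel_right, lt_add_iff_pos_left,
    ha, true_and, mul_pos_iff_of_pos_left]
  split_ifs with hb
  · have hs : ∑ i, (v i : ℂ) * (2 * Real.pi * I * w i) =
        2 * Real.pi * I * ∑ i, (v i : ℂ) * w i := by
      rw [Finset.mul_sum]
      exact Finset.sum_congr rfl fun _ _ => by ring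
    have hexp : cexp (2 * Real.pi * I * (a * z₁ + ∑ i, (v i : ℂ) * w i + (b + q / a : ℝ) * z₂)) =
        cexp (2 * Real.pi * I * a * z₁) * cexp (-(-(2 * Real.pi * I * z₂) * b)) *
          cexp (-((-(2 * Real.pi * I * z₂)) / a * q) +
            ∑ i, (v i : ℂ) * (2 * Real.pi * I * w i)) := by
      rw [← Complex.exp_add, ← Complex.exp_add, hs]
      congr 1
      push_cast
      field_simp
      ring
    rw [Real.mul_rpow ha.le hb.le, hexp]
    push_cast
    ring
  · rfl

lemma integral_coneKernel_mid (hM : M.det ≠ 0) (hσ : 0 ≤ σ) (hz₂ : 0 < z₂.im) {a : ℝ}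
    (ha : 0 < a) :
    ∫ v, ∫ b, coneKernel M σ z₁ w z₂ a v b =
      (1 / (-(2 * Real.pi * I * z₂))) ^ ((σ + 1 : ℝ) : ℂ) * (Real.Gamma (σ + 1) : ℂ) *
        (|M.det| * (2 * Real.pi / (-(2 * Real.pi * I * z₂))) ^ (Fintype.card ι / 2 : ℂ)) *
        (((a ^ (σ + Fintype.card ι / 2) : ℝ) : ℂ) * cexp (-(coneParam M z₁ w z₂ * a))) := by
  have hre : 0 < (-(2 * Real.pi * I * z₂)).re := by
    simp; positivity
  set r := -(2 * Real.pi * I * z₂) with hr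
  have hr0 : r ≠ 0 := fun h => by simp [h] at hre
  have hz0 : z₂ ≠ 0 := fun h => by simp [h] at hz₂
  have ha' : (a : ℂ) ≠ 0 := by exact_mod_cast ha.ne'
  simp_rw [integral_coneKernel_last hσ hz₂ ha, ← hr]
  have hβ : 0 < (r / a).re := by rw [Complex.div_ofReal_re]; positivity
  rw [integral_const_mul, integral_cexp_invQuad hM hβ]
  have h2 : (2 * Real.pi / (r / a) : ℂ) = (a : ℂ) * (2 * Real.pi / r) := by field_simp
  have hpi : (Real.pi : ℂ) ≠ 0 := by exact_mod_cast Real.pi_ne_zero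
  rw [h2, ofReal_mul_cpow ha (div_ne_zero (mul_ne_zero two_ne_zero hpi) hr0),
    Real.rpow_add ha]
  have h3 : (a : ℂ) ^ (Fintype.card ι / 2 : ℂ) = ((a ^ (Fintype.card ι / 2 : ℝ) : ℝ) : ℂ) := by
    rw [Complex.ofReal_cpow ha.le]; push_cast; rfl
  have h4 : cexp (-(coneParam M z₁ w z₂ * a)) = cexp (2 * Real.pi * I * a * z₁) *
      cexp ((∑ j, transMul M (fun i => 2 * Real.pi * I * w i) j ^ 2) / (2 * (r / a))) := by
    rw [← Complex.exp_add]
    congr 1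
    simp only [transMul_const_mul, mul_pow, ← Finset.mul_sum, coneParam, hr]
    field_simp
    ring
  rw [h3, h4]
  push_cast
  ring

end ConeKernel

section ConeIntegral

open MeasureTheory Set

lemma integral_coneKernel {ι : Type*} [Fintype ι] [DecidableEq ι] {M : Matrix ι ι ℝ} {σ : ℝ}
    {z₁ z₂ : ℂ} {w : ι → ℂ} (hM : M.det ≠ 0) (hσ : 0 ≤ σ) (hz₂ : 0 < z₂.im)
    (hz : (∑ j, (transMul M w j).im ^ 2) / 2 < z₁.im * z₂.im) {s : ℝ}
    (hs : s = σ + Fintype.card ι / 2 + 1) :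
    ∫ a, ∫ v, ∫ b, coneKernel M σ z₁ w z₂ a v b =
      ((|M.det| * Real.Gamma (σ + 1) * Real.Gamma s *
        (2 * Real.pi) ^ (Fintype.card ι / 2 : ℝ) : ℝ) : ℂ) * ((1 / (-(2 * Real.pi * I * z₂))) ^ (s : ℂ) * (1 / coneParam M z₁ w z₂) ^ (s : ℂ)) := by
  have hre : 0 < (-(2 * Real.pi * I * z₂)).re := by
    simp; positivity
  set r := -(2 * Real.pi * I * z₂) with hr
  have hr0 : r ≠ 0 := fun h => by simp [h] at hre
  have hs0 : 0 < s := by rw [hs]; positivity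
  set κ : ℂ := (1 / r) ^ ((σ + 1 : ℝ) : ℂ) * (Real.Gamma (σ + 1) : ℂ) *
        (|M.det| * (2 * Real.pi / r) ^ (Fintype.card ι / 2 : ℂ)) with hκ
  have h1 : (fun a => ∫ v, ∫ b, coneKernel M σ z₁ w z₂ a v b) =
      (Ioi (0 : ℝ)).indicator fun a => κ *
        (((a ^ (s - 1) : ℝ) : ℂ) * cexp (-(coneParam M z₁ w z₂ * a))) := by
    ext a
    by_cases ha : 0 < a
    · rw [indicator_of_mem (mem_Ioi.2 ha), integral_coneKernel_mid hM hσ hz₂ ha, hs,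
        add_sub_cancel_right]
    · rw [indicator_of_notMem (notMem_Ioi.2 (not_lt.1 ha))]
      simp [coneKernel, ha]
  rw [h1, integral_indicator measurableSet_Ioi, integral_const_mul,
    integral_rpow_mul_cexp_neg_mul_Ioi hs0 (coneParam_re_pos hz₂ hz), hκ]
  have h2 : (2 * Real.pi / r : ℂ) = ((2 * Real.pi : ℝ) : ℂ) * (1 / r) := by
    push_cast; ring
  have h3 : (1 / r) ^ (s : ℂ) =
      (1 / r) ^ ((σ + 1 : ℝ) : ℂ) * (1 / r) ^ (Fintype.card ι / 2 : ℂ) := by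
    rw [← Complex.cpow_add _ _ (one_div_ne_zero hr0), hs]
    congr 1
    push_cast
    ring
  have h4 : (((2 * Real.pi : ℝ) ^ (Fintype.card ι / 2 : ℝ) : ℝ) : ℂ) =
      ((2 * Real.pi : ℝ) : ℂ) ^ (Fintype.card ι / 2 : ℂ) := by
    rw [Complex.ofReal_cpow Real.two_pi_pos.le]; push_cast; rfl
  rw [h2, ofReal_mul_cpow Real.two_pi_pos (one_div_ne_zero hr0), h3, ← h4]
  push_cast
  ring

variable {n : ℕ}

lemma integral_fin_add_two {f : ℝ → (Fin n → ℝ) → ℝ → ℂ}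
    (hf : Integrable fun x : Fin (n + 2) → ℝ =>
      f (x 0) (fun i => x i.castSucc.succ) (x (Fin.last n).succ)) :
    ∫ x : Fin (n + 2) → ℝ, f (x 0) (fun i => x i.castSucc.succ) (x (Fin.last n).succ) =
      ∫ a, ∫ v, ∫ b, f a v b := by
  set G : ℝ × (Fin (n + 1) → ℝ) → ℂ := fun p =>
    f p.1 (fun i => p.2 i.castSucc) (p.2 (Fin.last n)) with hG
  have mp1 := volume_preserving_piFinSuccAbove (fun _ : Fin (n + 2) => ℝ) 0
  have mp2 := volume_preserving_piFinSuccAbove (fun _ : Fin (n + 1) => ℝ) (Fin.last n)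
  have e1 : (fun x : Fin (n + 2) → ℝ =>
      f (x 0) (fun i => x i.castSucc.succ) (x (Fin.last n).succ)) =
      G ∘ MeasurableEquiv.piFinSuccAbove (fun _ : Fin (n + 2) => ℝ) 0 := by
    ext x; rfl
  have hGi : Integrable G := by
    rw [e1] at hf
    exact (mp1.integrable_comp_emb (MeasurableEquiv.measurableEmbedding _)).1 hf
  have e2 : ∀ a, (fun y : Fin (n + 1) → ℝ => G (a, y)) =
      (fun q : ℝ × (Fin n → ℝ) => f a q.2 q.1) ∘
        MeasurableEquiv.piFinSuccAbove (fun _ : Fin (n + 1) => ℝ) (Fin.last n) := by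
    intro a
    ext y
    simp only [hG, Function.comp_apply, MeasurableEquiv.piFinSuccAbove_apply,
      Fin.insertNthEquiv_symm_apply]
    congr 1
    ext i
    simp [Fin.removeNth]
  calc _ = ∫ p, G p := by
        rw [e1]; exact mp1.integral_comp' G
    _ = ∫ a, ∫ y, G (a, y) := integral_prod G hGi
    _ = _ := by
        refine integral_congr_ae ?_
        filter_upwards [hGi.prod_right_ae] with a ha
        rw [e2] at ha
        have hi := (mp2.integrable_comp_emb (MeasurableEquiv.measurableEmbedding _)).1 ha
        have h1 : ∫ y, G (a, y) = ∫ q : ℝ × (Fin n → ℝ), f a q.2 q.1 := by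
          rw [e2]; exact mp2.integral_comp' (fun q : ℝ × (Fin n → ℝ) => f a q.2 q.1)
        rw [h1]
        exact integral_prod_symm _ hi

end ConeIntegral

section ConeDecay

open MeasureTheory Set

lemma exists_rpow_le_mul_exp (m : ℝ) {c : ℝ} (hc : 0 < c) :
    ∃ C, ∀ t : ℝ, 0 ≤ t → (1 + t) ^ m ≤ C * Real.exp (c * t) := by
  obtain ⟨j, hj⟩ := exists_nat_ge m
  refine ⟨(j.factorial : ℝ) * Real.exp c / c ^ j, fun t ht => ?_⟩
  have h1 : (1 + t) ^ m ≤ (1 + t) ^ j := by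
    rw [← Real.rpow_natCast]
    exact Real.rpow_le_rpow_of_exponent_le (by linarith) hj
  have h2 := Real.pow_div_factorial_le_exp (c * (1 + t)) (by positivity) j
  rw [div_le_iff₀ (by positivity), mul_pow, mul_add, mul_one, Real.exp_add] at h2
  refine h1.trans ?_
  rw [div_mul_eq_mul_div, le_div_iff₀ (by positivity)]
  linarith

variable {ι : Type*} [Fintype ι] [DecidableEq ι] {M : Matrix ι ι ℝ} {σ : ℝ} {z₁ z₂ : ℂ} {w : ι → ℂ}

lemma im_sum_mul (hM : M.det ≠ 0) (v : ι → ℝ) (w : ι → ℂ) :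
    (∑ i, (v i : ℂ) * w i).im = ∑ j, (transMul M w j).im * (M⁻¹ *ᵥ v) j := by
  have h : v = M *ᵥ (M⁻¹ *ᵥ v) := by
    rw [Matrix.mulVec_mulVec, Matrix.mul_nonsing_inv _ (isUnit_iff_ne_zero.2 hM),
      Matrix.one_mulVec]
  conv_lhs => rw [h]
  rw [sum_mulVec_mul, Complex.im_sum]
  exact Finset.sum_congr rfl fun j _ => Complex.im_mul_ofReal _ _

lemma exists_le_im_cone (hM : M.det ≠ 0) (hz₂ : 0 < z₂.im)
    (hz : (∑ j, (transMul M w j).im ^ 2) / 2 < z₁.im * z₂.im) :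
    ∃ c, 0 < c ∧ ∀ (a : ℝ) (v : ι → ℝ) (b : ℝ), 0 < a → invQuad M v < a * b →
      c * (a + b) ≤ (a * z₁ + ∑ i, (v i : ℂ) * w i + b * z₂).im := by
  set T := (∑ j, (transMul M w j).im ^ 2) / 2 with hT
  have hT0 : 0 ≤ T := by positivity
  have hz₁ : 0 < z₁.im := pos_of_mul_pos_left (hT0.trans_lt hz) hz₂.le
  set D := z₁.im * z₂.im with hD
  have hD0 : 0 < D := mul_pos hz₁ hz₂
  set θ := Real.sqrt (T / D) with hθ
  have hθ0 : 0 ≤ θ := Real.sqrt_nonneg _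
  have hθ1 : θ < 1 := by
    rw [hθ, Real.sqrt_lt' one_pos, one_pow, div_lt_one hD0]
    exact hz
  have hθT : T = θ ^ 2 * D := by
    rw [hθ, Real.sq_sqrt (by positivity), div_mul_cancel₀ _ hD0.ne']
  refine ⟨(1 - θ) * min z₁.im z₂.im, mul_pos (by linarith) (lt_min hz₁ hz₂),
    fun a v b ha hab => ?_⟩
  have hb : 0 < b := pos_of_mul_pos_right ((invQuad_nonneg M v).trans_lt hab) ha.le
  have him : (a * z₁ + ∑ i, (v i : ℂ) * w i + b * z₂).im =
      a * z₁.im + ∑ j, (transMul M w j).im * (M⁻¹ *ᵥ v) j + b * z₂.im := by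
    rw [Complex.add_im, Complex.add_im, im_sum_mul hM, Complex.im_ofReal_mul, Complex.im_ofReal_mul]
  set P := ∑ j, (transMul M w j).im * (M⁻¹ *ᵥ v) j with hP
  have hcs : P ^ 2 ≤ (2 * T) * (2 * invQuad M v) := by
    have := Finset.sum_mul_sq_le_sq_mul_sq Finset.univ (fun j => (transMul M w j).im) (M⁻¹ *ᵥ v)
    rw [hT, invQuad, mul_div_cancel₀ _ two_ne_zero, mul_div_cancel₀ _ two_ne_zero]
    exact this
  have hP2 : P ^ 2 ≤ (θ * (a * z₁.im + b * z₂.im)) ^ 2 := by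
    calc P ^ 2 ≤ (2 * T) * (2 * invQuad M v) := hcs
      _ ≤ (2 * T) * (2 * (a * b)) := by gcongr
      _ = θ ^ 2 * (4 * (a * z₁.im) * (b * z₂.im)) := by rw [hθT, hD]; ring
      _ ≤ θ ^ 2 * (a * z₁.im + b * z₂.im) ^ 2 := by
        gcongr
        nlinarith [sq_nonneg (a * z₁.im - b * z₂.im)]
      _ = _ := by ring
  have hP3 := (abs_le_of_sq_le_sq' hP2 (by positivity)).1
  have h1 : min z₁.im z₂.im * (a + b) ≤ a * z₁.im + b * z₂.im := by
    nlinarith [min_le_left z₁.im z₂.im, min_le_right z₁.im z₂.im]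
  rw [him]
  nlinarith [mul_le_mul_of_nonneg_left h1 (by linarith : 0 ≤ 1 - θ)]

lemma exists_abs_le_of_invQuad_lt (hM : M.det ≠ 0) :
    ∃ K, 1 ≤ K ∧ ∀ (a : ℝ) (v : ι → ℝ) (b : ℝ), 0 < a → invQuad M v < a * b →
      ∀ i, |v i| ≤ K * (a + b) := by
  refine ⟨1 + ∑ i, ∑ j, |M i j|, le_add_of_nonneg_right (by positivity), fun a v b ha hab i => ?_⟩
  have hb : 0 < b := pos_of_mul_pos_right ((invQuad_nonneg M v).trans_lt hab) ha.le
  have hv : v i = ∑ j, M i j * (M⁻¹ *ᵥ v) j := by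
    change v i = (M *ᵥ (M⁻¹ *ᵥ v)) i
    rw [Matrix.mulVec_mulVec, Matrix.mul_nonsing_inv _ (isUnit_iff_ne_zero.2 hM),
      Matrix.one_mulVec]
  have hp : ∀ j, |(M⁻¹ *ᵥ v) j| ≤ a + b := by
    intro j
    have h1 : (M⁻¹ *ᵥ v) j ^ 2 ≤ ∑ i, (M⁻¹ *ᵥ v) i ^ 2 :=
      Finset.single_le_sum (f := fun i => (M⁻¹ *ᵥ v) i ^ 2) (fun _ _ => sq_nonneg _)
        (Finset.mem_univ j)
    refine abs_le_of_sq_le_sq ?_ (by linarith)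
    unfold invQuad at hab
    nlinarith [sq_nonneg a, sq_nonneg b]
  calc |v i| ≤ ∑ j, |M i j * (M⁻¹ *ᵥ v) j| := by rw [hv]; exact Finset.abs_sum_le_sum_abs _ _
    _ ≤ ∑ j, |M i j| * (a + b) := by
      gcongr with j
      rw [abs_mul]
      exact mul_le_mul_of_nonneg_left (hp j) (abs_nonneg _)
    _ = (∑ j, |M i j|) * (a + b) := by rw [Finset.sum_mul]
    _ ≤ _ := by
      gcongr
      have := Finset.single_le_sum (f := fun i => ∑ j, |M i j|) (fun _ _ => by positivity)
        (Finset.mem_univ i)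
      linarith

variable {n : ℕ}

/-- The cone kernel as a function of a single vector. -/
noncomputable def coneFun (M : Matrix (Fin n) (Fin n) ℝ) (σ : ℝ) (z : Fin (n + 2) → ℂ)
    (x : Fin (n + 2) → ℝ) : ℂ :=
  coneKernel M σ (z 0) (fun i => z i.castSucc.succ) (z (Fin.last n).succ)
    (x 0) (fun i => x i.castSucc.succ) (x (Fin.last n).succ)

/-- The imaginary part of `z` lies in the positive cone attached to `M`. -/
def InTube (M : Matrix (Fin n) (Fin n) ℝ) (z : Fin (n + 2) → ℂ) : Prop :=
  0 < (z (Fin.last n).succ).im ∧ (∑ j, (transMul M (fun i => z i.castSucc.succ) j).im ^ 2) / 2 <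
    (z 0).im * (z (Fin.last n).succ).im

variable {M : Matrix (Fin n) (Fin n) ℝ} {z : Fin (n + 2) → ℂ}

lemma exists_norm_coneFun_le (hM : M.det ≠ 0) (hσ : 0 ≤ σ) (hz : InTube M z) :
    ∃ C, ∀ x, ‖coneFun M σ z x‖ ≤ C * polyWeight x := by
  obtain ⟨c, hc, hcone⟩ := exists_le_im_cone hM hz.1 hz.2
  obtain ⟨K, hK, hbd⟩ := exists_abs_le_of_invQuad_lt hM
  set N : ℝ := (Fintype.card (Fin (n + 2)) : ℝ) + 1 with hN
  have hN0 : 0 ≤ N := by positivity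
  obtain ⟨C, hC⟩ := exists_rpow_le_mul_exp (2 * σ + N) (c := 2 * Real.pi * c) (by positivity)
  refine ⟨K ^ N * C, fun x => ?_⟩
  have hC0 : 0 ≤ C := by
    have := hC 0 le_rfl
    simp only [add_zero, Real.one_rpow, mul_zero, Real.exp_zero, mul_one] at this
    linarith
  set a := x 0 with ha'
  set v : Fin n → ℝ := fun i => x i.castSucc.succ with hv
  set b := x (Fin.last n).succ with hb'
  by_cases h : 0 < a ∧ invQuad M v < a * b
  · obtain ⟨ha, hab⟩ := h
    have hq := invQuad_nonneg M v
    have hb : 0 < b := pos_of_mul_pos_right (hq.trans_lt hab) ha.le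
    have hx : ‖x‖ ≤ K * (a + b) := by
      refine (pi_norm_le_iff_of_nonneg (by positivity)).2 fun i => ?_
      rw [Real.norm_eq_abs]
      refine Fin.cases ?_ (fun i => Fin.lastCases ?_ (fun i => ?_) i) i
      · rw [← ha', abs_of_pos ha]; nlinarith
      · rw [← hb', abs_of_pos hb]; nlinarith
      · exact hbd a v b ha hab i
    have h1 : ‖coneFun M σ z x‖ ≤ (1 + (a + b)) ^ (2 * σ) *
        Real.exp (-(2 * Real.pi * c * (a + b))) := by
      simp only [coneFun, coneKernel]
      rw [if_pos ⟨ha, hab⟩, norm_mul, Complex.norm_real, Complex.norm_exp, Real.norm_eq_abs,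
        abs_of_nonneg (Real.rpow_nonneg (by linarith) _)]
      refine mul_le_mul ?_ (Real.exp_le_exp.2 ?_) (Real.exp_pos _).le (by positivity)
      · rw [Real.rpow_mul (by positivity), Real.rpow_two]
        refine Real.rpow_le_rpow (by linarith) ?_ hσ
        nlinarith
      · have h2 := hcone a v b ha hab
        rw [show ∀ u : ℂ, (2 * Real.pi * I * u).re = -(2 * Real.pi * u.im) by
          intro u; simp]
        nlinarith [Real.pi_pos]
    have h3 : (1 + ‖x‖) ^ N ≤ K ^ N * (1 + (a + b)) ^ N := by
      rw [← Real.mul_rpow (by positivity) (by positivity)]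
      refine Real.rpow_le_rpow (by positivity) ?_ hN0
      nlinarith
    unfold polyWeight
    rw [← hN, Real.rpow_neg (by positivity), ← div_eq_mul_inv, le_div_iff₀ (by positivity)]
    calc ‖coneFun M σ z x‖ * (1 + ‖x‖) ^ N
        ≤ ((1 + (a + b)) ^ (2 * σ) * Real.exp (-(2 * Real.pi * c * (a + b)))) *
          (K ^ N * (1 + (a + b)) ^ N) := by gcongr
      _ = K ^ N * ((1 + (a + b)) ^ (2 * σ + N) * Real.exp (-(2 * Real.pi * c * (a + b)))) := by
        rw [Real.rpow_add (by positivity : 0 < 1 + (a + b)) (2 * σ)]; ring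
      _ ≤ K ^ N * (C * Real.exp (2 * Real.pi * c * (a + b)) *
          Real.exp (-(2 * Real.pi * c * (a + b)))) := by
        gcongr
        exact hC _ (by positivity)
      _ = K ^ N * C := by
        rw [mul_assoc C, ← Real.exp_add, add_neg_cancel, Real.exp_zero, mul_one]
  · have : coneFun M σ z x = 0 := by
      simp only [coneFun, coneKernel]
      exact if_neg h
    rw [this, norm_zero]
    have := polyWeight_pos x
    positivity

lemma measurable_coneFun : Measurable (coneFun M σ z) := by
  have hq := (continuous_invQuad M).measurable
  unfold coneFun coneKernel
  refine Measurable.ite ?_ (by fun_prop) measurable_const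
  exact (measurableSet_lt measurable_const (measurable_pi_apply _)).inter
    (measurableSet_lt
      (by fun_prop : Measurable fun x : Fin (n + 2) → ℝ => invQuad M fun i => x i.castSucc.succ)
      (by fun_prop : Measurable fun x : Fin (n + 2) → ℝ => x 0 * x (Fin.last n).succ))

lemma continuous_coneFun (hσ : 0 < σ) : Continuous (coneFun M σ z) := by
  have hq := continuous_invQuad M
  have h : coneFun M σ z = fun x => if x 0 ≤ 0 then 0 else
      (((max (x 0 * x (Fin.last n).succ - invQuad M (fun i => x i.castSucc.succ)) 0) ^ σ : ℝ) : ℂ) *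
        cexp (2 * Real.pi * I * (x 0 * z 0 + ∑ i : Fin n, (x i.castSucc.succ : ℂ) *
          z i.castSucc.succ + x (Fin.last n).succ * z (Fin.last n).succ)) := by
    ext x
    simp only [coneFun, coneKernel]
    by_cases ha : 0 < x 0
    · rw [if_neg (not_le.2 ha)]
      by_cases hab : invQuad M (fun i => x i.castSucc.succ) < x 0 * x (Fin.last n).succ
      · rw [if_pos ⟨ha, hab⟩, max_eq_left (by linarith)]
      · rw [if_neg (fun h => hab h.2), max_eq_right (by linarith), Real.zero_rpow hσ.ne']
        simp
    · rw [if_neg (fun h => ha h.1), if_pos (not_lt.1 ha)]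
  rw [h]
  refine Continuous.if_le continuous_const ?_ (continuous_apply _) continuous_const ?_
  · refine Continuous.mul (Complex.continuous_ofReal.comp (Continuous.rpow_const ?_ fun _ =>
      Or.inr hσ.le)) ?_
    · fun_prop
    · fun_prop
  · intro x hx
    rw [hx, zero_mul, max_eq_right (by linarith [invQuad_nonneg M (fun i => x i.castSucc.succ)]),
      Real.zero_rpow hσ.ne']
    simp

end ConeDecay

section ConePoisson

open MeasureTheory Set

variable {n : ℕ} {M : Matrix (Fin n) (Fin n) ℝ} {σ : ℝ} {z : Fin (n + 2) → ℂ}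

/-- The quadratic form `z₀ z_{n+1} - ½ |Mᵀ w|²`, where `w` is the middle part of `z`. -/
noncomputable def tubeQuad (M : Matrix (Fin n) (Fin n) ℝ) (z : Fin (n + 2) → ℂ) : ℂ :=
  z 0 * z (Fin.last n).succ - (∑ j, transMul M (fun i => z i.castSucc.succ) j ^ 2) / 2

lemma InTube.sub_intCast (hz : InTube M z) (m : Fin (n + 2) → ℤ) :
    InTube M fun i => z i - m i := by
  have h : ∀ j, (transMul M (fun i => z i.castSucc.succ - (m i.castSucc.succ : ℂ)) j).im =
      (transMul M (fun i => z i.castSucc.succ) j).im := by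
    intro j
    simp only [transMul, Complex.im_sum, Complex.im_ofReal_mul, Complex.sub_im, Complex.intCast_im,
      sub_zero]
  simpa only [InTube, h, Complex.sub_im, Complex.intCast_im, sub_zero] using hz

lemma cexp_mul_coneFun (m : Fin (n + 2) → ℤ) (x : Fin (n + 2) → ℝ) :
    cexp (-(2 * Real.pi * I * ∑ i, (m i : ℂ) * x i)) * coneFun M σ z x =
      coneFun M σ (fun i => z i - m i) x := by
  simp only [coneFun, coneKernel]
  split_ifs
  · rw [mul_left_comm, ← Complex.exp_add]
    congr 2
    rw [Fin.sum_univ_succ, Fin.sum_univ_castSucc]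
    simp only [mul_sub, Finset.sum_sub_distrib, mul_comm (x _ : ℂ) (m _ : ℂ)]
    ring
  · rw [mul_zero]

lemma coneParam_mul (hz : InTube M z) :
    (-(2 * Real.pi * I * z (Fin.last n).succ)) *
      coneParam M (z 0) (fun i => z i.castSucc.succ) (z (Fin.last n).succ) =
        ((2 * Real.pi) ^ 2 : ℝ) * -tubeQuad M z := by
  have h0 : z (Fin.last n).succ ≠ 0 := fun h => by
    have h1 := hz.1
    rw [h, Complex.zero_im] at h1
    exact h1.false
  unfold coneParam tubeQuad
  push_cast
  field_simp
  linear_combination (2 * (z 0 * z (Fin.last n).succ) -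
    ∑ j, transMul M (fun i => z i.castSucc.succ) j ^ 2) * Complex.I_sq

/-- The constant in the Fourier transform of the cone kernel. -/
noncomputable def coneConst (M : Matrix (Fin n) (Fin n) ℝ) (σ s : ℝ) : ℝ :=
  |M.det| * Real.Gamma (σ + 1) * Real.Gamma s * (2 * Real.pi) ^ ((n : ℝ) / 2)

lemma coneConst_pos (hM : M.det ≠ 0) (hσ : 0 ≤ σ) {s : ℝ} (hs : 0 < s) :
    0 < coneConst M σ s := by
  have h1 : 0 < Real.Gamma (σ + 1) := Real.Gamma_pos_of_pos (by linarith)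
  have h2 := Real.Gamma_pos_of_pos hs
  have h3 := abs_pos.2 hM
  unfold coneConst
  positivity

lemma latticeFourier_coneFun (hM : M.det ≠ 0) (hσ : 0 ≤ σ) (hz : InTube M z) {s : ℝ}
    (hs : s = σ + n / 2 + 1) (m : Fin (n + 2) → ℤ) :
    ∃ p q : ℂ, p * q = ((2 * Real.pi) ^ 2 : ℝ) * -tubeQuad M (fun i => z i - m i) ∧
      latticeFourier (coneFun M σ z) m =
        (coneConst M σ s : ℂ) * ((1 / p) ^ (s : ℂ) * (1 / q) ^ (s : ℂ)) := by
  have hz' := hz.sub_intCast m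
  refine ⟨_, _, coneParam_mul hz', ?_⟩
  obtain ⟨C, hC⟩ := exists_norm_coneFun_le hM hσ hz'
  set z' : Fin (n + 2) → ℂ := fun i => z i - m i
  have hi := integral_fin_add_two (f := coneKernel M σ (z' 0) (fun i => z' i.castSucc.succ)
    (z' (Fin.last n).succ)) (integrable_of_polyWeight measurable_coneFun hC)
  have hl : latticeFourier (coneFun M σ z) m = ∫ x, coneFun M σ z' x :=
    integral_congr_ae (ae_of_all _ (cexp_mul_coneFun m))
  rw [hl]
  unfold coneFun
  rw [hi, integral_coneKernel hM hσ hz'.1 hz'.2 (s := s) (by simpa using hs), Fintype.card_fin]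
  rfl

lemma norm_latticeFourier_coneFun (hM : M.det ≠ 0) (hσ : 0 ≤ σ) (hz : InTube M z) {s : ℝ}
    (hs : s = σ + n / 2 + 1) (m : Fin (n + 2) → ℤ) :
    ‖latticeFourier (coneFun M σ z) m‖ = coneConst M σ s *
      (((2 * Real.pi) ^ 2)⁻¹ ^ s * ‖(-tubeQuad M (fun i => z i - m i))⁻¹‖ ^ s) := by
  have hs0 : 0 < s := by rw [hs]; positivity
  obtain ⟨p, q, hpq, h⟩ := latticeFourier_coneFun hM hσ hz hs m
  rw [h, norm_mul, norm_mul, Complex.norm_real, Complex.norm_cpow_real, Complex.norm_cpow_real,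
    Real.norm_eq_abs, abs_of_pos (coneConst_pos hM hσ hs0),
    ← Real.mul_rpow (norm_nonneg _) (norm_nonneg _), ← norm_mul, one_div_mul_one_div, hpq,
    ← Real.mul_rpow (by positivity) (norm_nonneg _), one_div, mul_inv, norm_mul,
    ← Complex.ofReal_inv, Complex.norm_real, Real.norm_eq_abs, abs_of_nonneg (by positivity)]

lemma summable_norm_tubeQuad (hM : M.det ≠ 0) (hz : InTube M z) {k : ℕ} (hk : n + 1 < k) :
    Summable fun m : Fin (n + 2) → ℤ => ‖(-tubeQuad M fun i => z i - m i) ^ (-(k : ℤ))‖ := by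
  have hk' : (n : ℝ) + 2 ≤ k := by exact_mod_cast hk
  set σ : ℝ := (k : ℝ) / 2 - n / 2 - 1 with hσ'
  have hσ : 0 ≤ σ := by linarith
  have hs : (k : ℝ) / 2 = σ + n / 2 + 1 := by rw [hσ']; ring
  have hs0 : 0 < (k : ℝ) / 2 := by rw [hs]; positivity
  obtain ⟨C, hC⟩ := exists_norm_coneFun_le hM hσ hz
  have h := summable_sq_latticeFourier measurable_coneFun hC
  have hpos : 0 < (coneConst M σ ((k : ℝ) / 2) * ((2 * Real.pi) ^ 2)⁻¹ ^ ((k : ℝ) / 2)) ^ 2 := by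
    have := coneConst_pos hM hσ hs0
    positivity
  rw [← summable_mul_left_iff hpos.ne']
  refine h.congr fun m => ?_
  rw [norm_latticeFourier_coneFun hM hσ hz hs, ← mul_assoc, mul_pow]
  congr 1
  rw [← Real.rpow_natCast, ← Real.rpow_mul (norm_nonneg _), Nat.cast_ofNat,
    div_mul_cancel₀ _ two_ne_zero, Real.rpow_natCast, ← norm_pow, inv_pow, _root_.zpow_neg,
    zpow_natCast]

lemma tsum_coneFun (hM : M.det ≠ 0) (hz : InTube M z) {k : ℕ} (hk : n + 1 < k) :
    ∑' m : Fin (n + 2) → ℤ, coneFun M ((k : ℝ) - (n + 2) / 2) z (fun i => (m i : ℝ)) =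
      ((coneConst M ((k : ℝ) - (n + 2) / 2) k * ((2 * Real.pi) ^ 2)⁻¹ ^ k : ℝ) : ℂ) *
        ∑' m : Fin (n + 2) → ℤ, (-tubeQuad M fun i => z i - m i) ^ (-(k : ℤ)) := by
  have hk' : (n : ℝ) + 2 ≤ k := by exact_mod_cast hk
  set σ : ℝ := (k : ℝ) - (n + 2) / 2 with hσ'
  have hσ : 0 < σ := by
    have : (0 : ℝ) ≤ n := n.cast_nonneg
    rw [hσ']; linarith
  have hs : (k : ℝ) = σ + n / 2 + 1 := by rw [hσ']; ring
  obtain ⟨C, hC⟩ := exists_norm_coneFun_le hM hσ.le hz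
  have hco : ∀ m, latticeFourier (coneFun M σ z) m =
      ((coneConst M σ k * ((2 * Real.pi) ^ 2)⁻¹ ^ k : ℝ) : ℂ) *
        (-tubeQuad M fun i => z i - m i) ^ (-(k : ℤ)) := by
    intro m
    obtain ⟨p, q, hpq, h⟩ := latticeFourier_coneFun hM hσ.le hz hs m
    rw [h, Complex.ofReal_natCast, Complex.cpow_natCast, Complex.cpow_natCast, ← mul_pow,
      one_div_mul_one_div, hpq, one_div, mul_inv, mul_pow, _root_.zpow_neg, zpow_natCast,
      ← inv_pow (-_), Complex.ofReal_mul (coneConst _ _ _),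
      Complex.ofReal_pow (_⁻¹), Complex.ofReal_inv, mul_assoc]
  rw [tsum_eq_tsum_latticeFourier (continuous_coneFun hσ) hC, ← tsum_mul_left]
  · exact tsum_congr hco
  · rw [funext hco]
    exact ((summable_norm_tubeQuad hM hz hk).of_norm).mul_left _

end ConePoisson

section GramMatrix

open scoped MatrixOrder in
lemma exists_mul_transpose_eq {n : ℕ} {S : Matrix (Fin n) (Fin n) ℤ} (hsymm : S.IsSymm)
    (hpos : ∀ v : Fin n → ℝ, v ≠ 0 → 0 < bilin ℝ S v v) :
    ∃ M : Matrix (Fin n) (Fin n) ℝ, M * Mᵀ = S.map (Int.cast : ℤ → ℝ) ∧ M.det ≠ 0 ∧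
      |M.det| = Real.sqrt ((S.det : ℤ) : ℝ) := by
  have hP : (S.map (Int.cast : ℤ → ℝ)).PosDef := by
    refine Matrix.PosDef.of_dotProduct_mulVec_pos ?_ fun {x} hx => hpos x hx
    rw [Matrix.IsHermitian, Matrix.conjTranspose_eq_transpose_of_trivial, ← Matrix.transpose_map,
      hsymm.eq]
  obtain ⟨B, hB⟩ := CStarAlgebra.nonneg_iff_eq_star_mul_self.mp hP.posSemidef.nonneg
  rw [Matrix.star_eq_conjTranspose, Matrix.conjTranspose_eq_transpose_of_trivial] at hB
  have hdet : ((S.det : ℤ) : ℝ) = Bᵀ.det ^ 2 := by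
    have h := Int.cast_det (R := ℝ) S
    rw [h, hB, Matrix.det_mul, Matrix.det_transpose, sq]
  refine ⟨Bᵀ, by rw [Matrix.transpose_transpose, hB], fun h => ?_, ?_⟩
  · have := hP.det_pos.ne'
    rw [hB, Matrix.det_mul, h, zero_mul] at this
    exact this rfl
  · rw [hdet, Real.sqrt_sq_eq_abs]

variable {n : ℕ} {S : Matrix (Fin n) (Fin n) ℤ}

lemma transMul_eq_mulVec {ι : Type*} [Fintype ι] (M : Matrix ι ι ℝ) (w : ι → ℂ) :
    transMul M w = (M.map Complex.ofReal)ᵀ *ᵥ w := by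
  ext j
  simp [transMul, Matrix.mulVec, dotProduct]

lemma sum_transpose_mulVec_sq {K ι : Type*} [CommRing K] [Fintype ι] (A : Matrix ι ι K)
    (w : ι → K) : ∑ j, (Aᵀ *ᵥ w) j ^ 2 = w ⬝ᵥ ((A * Aᵀ) *ᵥ w) := by
  rw [← Matrix.mulVec_mulVec, Matrix.dotProduct_mulVec, ← Matrix.mulVec_transpose]
  simp [dotProduct, sq]

section Components

variable {K : Type} [Field K] (v : Fin (n + 2) → K)

lemma MatS0_mulVec_zero :
    ((MatS0 n S).map (Int.cast : ℤ → K) *ᵥ v) 0 = v (Fin.last n).succ := by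
  rw [Matrix.mulVec, dotProduct, Fin.sum_univ_succ, Fin.sum_univ_castSucc]
  have h : ∀ i : Fin n, (i : ℕ) ≠ n := fun i => i.isLt.ne
  simp [MatS0, hyp, h]

lemma MatS0_mulVec_last :
    ((MatS0 n S).map (Int.cast : ℤ → K) *ᵥ v) (Fin.last n).succ = v 0 := by
  rw [Matrix.mulVec, dotProduct, Fin.sum_univ_succ, Fin.sum_univ_castSucc]
  simp [MatS0, hyp]

lemma MatS0_mulVec_mid (i : Fin n) :
    ((MatS0 n S).map (Int.cast : ℤ → K) *ᵥ v) i.castSucc.succ =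
      -(S.map (Int.cast : ℤ → K) *ᵥ fun j => v j.castSucc.succ) i := by
  rw [Matrix.mulVec, dotProduct, Fin.sum_univ_succ, Fin.sum_univ_castSucc]
  have h : ∀ i : Fin n, (i : ℕ) ≠ n := fun i => i.isLt.ne
  simp [MatS0, hyp, h, Matrix.mulVec, dotProduct]

lemma quadF_MatS0 [NeZero (2 : K)] :
    quadF K (MatS0 n S) v = v 0 * v (Fin.last n).succ -
      ((fun j => v j.castSucc.succ) ⬝ᵥ
        (S.map (Int.cast : ℤ → K) *ᵥ fun j => v j.castSucc.succ)) / 2 := by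
  rw [quadF, bilin, dotProduct, Fin.sum_univ_succ, Fin.sum_univ_castSucc]
  simp only [MatS0_mulVec_zero, MatS0_mulVec_mid, MatS0_mulVec_last, mul_neg,
    Finset.sum_neg_distrib]
  rw [dotProduct]
  field_simp
  ring

lemma bilin_MatS0_eq_sum (hsymm : S.IsSymm) (u : Fin (n + 2) → K) :
    bilin K (MatS0 n S) u v =
      ∑ i, ((MatS0 n S).map (Int.cast : ℤ → K) *ᵥ u) i * v i := by
  have hS : (S.map (Int.cast : ℤ → K))ᵀ = S.map Int.cast := by
    rw [← Matrix.transpose_map, hsymm.eq]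
  have hs : ∀ x y : Fin n → K, ∑ i, x i * (S.map (Int.cast : ℤ → K) *ᵥ y) i =
      ∑ i, (S.map (Int.cast : ℤ → K) *ᵥ x) i * y i := by
    intro x y
    change x ⬝ᵥ _ = _ ⬝ᵥ y
    rw [Matrix.dotProduct_mulVec, ← Matrix.mulVec_transpose, hS]
  rw [bilin, dotProduct, Fin.sum_univ_succ, Fin.sum_univ_castSucc, Fin.sum_univ_succ (n := n + 1),
    Fin.sum_univ_castSucc (n := n)]
  simp only [MatS0_mulVec_zero, MatS0_mulVec_mid, MatS0_mulVec_last, mul_neg, neg_mul,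
    Finset.sum_neg_distrib, hs (fun i => u i.castSucc.succ)]
  ring

end Components

variable {M : Matrix (Fin n) (Fin n) ℝ}

lemma tubeQuad_eq_quadF (hM : M * Mᵀ = S.map (Int.cast : ℤ → ℝ)) (z : Fin (n + 2) → ℂ) :
    tubeQuad M z = quadF ℂ (MatS0 n S) z := by
  have h : (M.map Complex.ofReal) * (M.map Complex.ofReal)ᵀ = S.map (Int.cast : ℤ → ℂ) := by
    have := congrArg (fun A : Matrix (Fin n) (Fin n) ℝ => A.map Complex.ofRealHom) hM
    simp only [Matrix.map_mul, Matrix.map_map] at this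
    convert this using 2
    · rfl
    · rfl
    · ext i
      simp
  rw [tubeQuad, quadF_MatS0, transMul_eq_mulVec, sum_transpose_mulVec_sq, h]

lemma inTube_of_mem_HS (hM : M * Mᵀ = S.map (Int.cast : ℤ → ℝ)) {z : Fin (n + 2) → ℂ}
    (hz : z ∈ HS n S) : InTube M z := by
  obtain ⟨h1, h2⟩ := hz
  rw [quadF_MatS0, ← hM, ← sum_transpose_mulVec_sq, sub_pos] at h1
  have h : ∀ j, (transMul M (fun i => z i.castSucc.succ) j).im =
      (Mᵀ *ᵥ fun i => (z i.castSucc.succ).im) j := by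
    intro j
    simp [transMul, Matrix.mulVec, dotProduct, Complex.im_sum]
  simp only [InTube, h]
  refine ⟨pos_of_mul_pos_right (lt_of_le_of_lt ?_ h1) h2.le, h1⟩
  positivity

lemma coneFun_MatS0_mulVec (hM : M * Mᵀ = S.map (Int.cast : ℤ → ℝ)) (hdet : M.det ≠ 0)
    (hsymm : S.IsSymm) (σ : ℝ) (z : Fin (n + 2) → ℂ) (x : Fin (n + 2) → ℝ)
    [Decidable (x ∈ PosCone n S)] :
    coneFun M σ z ((MatS0 n S).map (Int.cast : ℤ → ℝ) *ᵥ x) =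
      if x ∈ PosCone n S then ((quadF ℝ (MatS0 n S) x ^ σ : ℝ) : ℂ) *
        cexp (2 * Real.pi * I * bilin ℂ (MatS0 n S) (fun i => (x i : ℂ)) z) else 0 := by
  have hq : invQuad M (fun i => -(S.map (Int.cast : ℤ → ℝ) *ᵥ fun j => x j.castSucc.succ) i) =
      ((fun j => x j.castSucc.succ) ⬝ᵥ
        (S.map (Int.cast : ℤ → ℝ) *ᵥ fun j => x j.castSucc.succ)) / 2 := by
    rw [← hM, ← sum_transpose_mulVec_sq, invQuad]
    change (∑ i, (M⁻¹ *ᵥ (-((M * Mᵀ) *ᵥ fun j => x j.castSucc.succ))) i ^ 2) / 2 = _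
    rw [Matrix.mulVec_neg, Matrix.mulVec_mulVec, ← Matrix.mul_assoc,
      Matrix.nonsing_inv_mul _ (isUnit_iff_ne_zero.2 hdet), Matrix.one_mul]
    simp
  have hcond : (0 < x (Fin.last n).succ ∧ ((fun j => x j.castSucc.succ) ⬝ᵥ
        (S.map (Int.cast : ℤ → ℝ) *ᵥ fun j => x j.castSucc.succ)) / 2 <
          x (Fin.last n).succ * x 0) ↔ x ∈ PosCone n S := by
    have h0 : 0 ≤ ((fun j => x j.castSucc.succ) ⬝ᵥ
        (S.map (Int.cast : ℤ → ℝ) *ᵥ fun j => x j.castSucc.succ)) / 2 := by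
      rw [← hM, ← sum_transpose_mulVec_sq]; positivity
    rw [PosCone, Set.mem_ofPred_eq, quadF_MatS0, sub_pos, mul_comm (x 0)]
    constructor
    · rintro ⟨h1, h2⟩
      exact ⟨h2, pos_of_mul_pos_right (h0.trans_lt h2) h1.le⟩
    · rintro ⟨h1, h2⟩
      exact ⟨pos_of_mul_pos_left (h0.trans_lt h1) h2.le, h1⟩
  have hcast : ∀ i, (((MatS0 n S).map (Int.cast : ℤ → ℝ) *ᵥ x) i : ℂ) =
      ((MatS0 n S).map (Int.cast : ℤ → ℂ) *ᵥ fun i => (x i : ℂ)) i := by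
    intro i
    simp [Matrix.mulVec, dotProduct]
  have hsum := bilin_MatS0_eq_sum z hsymm (fun i => (x i : ℂ))
  simp only [← hcast] at hsum
  rw [Fin.sum_univ_succ, Fin.sum_univ_castSucc] at hsum
  simp only [MatS0_mulVec_zero, MatS0_mulVec_mid, MatS0_mulVec_last] at hsum
  simp only [coneFun, coneKernel, MatS0_mulVec_zero, MatS0_mulVec_mid, MatS0_mulVec_last, hq, hcond]
  rw [hsum, quadF_MatS0, mul_comm (x 0), add_assoc]

end GramMatrix

section DualLattice

variable {n : ℕ} {S : Matrix (Fin n) (Fin n) ℤ}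

lemma MatS0_mulVec_injective (hpos : ∀ v : Fin n → ℝ, v ≠ 0 → 0 < bilin ℝ S v v) :
    Function.Injective ((MatS0 n S).map (Int.cast : ℤ → ℚ)).mulVec := by
  rw [← Matrix.coe_mulVecLin, injective_iff_map_eq_zero]
  intro u hu
  rw [Matrix.mulVecLin_apply] at hu
  have hmid : (fun j : Fin n => ((u j.castSucc.succ : ℚ) : ℝ)) = 0 := by
    by_contra h
    refine (hpos _ h).ne' ?_
    rw [bilin, dotProduct]
    refine Finset.sum_eq_zero fun i _ => ?_
    have hi : (S.map (Int.cast : ℤ → ℚ) *ᵥ fun j => u j.castSucc.succ) i = 0 := by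
      rw [← neg_eq_zero, ← MatS0_mulVec_mid, hu, Pi.zero_apply]
    have hi' := congrArg (Rat.cast : ℚ → ℝ) hi
    simp only [Matrix.mulVec, dotProduct, Matrix.map_apply, Rat.cast_sum, Rat.cast_mul,
      Rat.cast_intCast, Rat.cast_zero] at hi' ⊢
    rw [hi', mul_zero]
  ext i
  refine Fin.cases ?_ (fun i => Fin.lastCases ?_ (fun i => ?_) i) i
  · rw [← MatS0_mulVec_last (S := S) u, hu]
    rfl
  · rw [← MatS0_mulVec_zero (S := S) u, hu]
    rfl
  · have := congrFun hmid i
    simpa using this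

lemma exists_MatS0_mulVec_eq (hpos : ∀ v : Fin n → ℝ, v ≠ 0 → 0 < bilin ℝ S v v)
    (w : Fin (n + 2) → ℚ) : ∃ v, (MatS0 n S).map (Int.cast : ℤ → ℚ) *ᵥ v = w :=
  Matrix.mulVec_surjective_iff_isUnit.2
    (Matrix.mulVec_injective_iff_isUnit.1 (MatS0_mulVec_injective hpos)) w

lemma ratCast_MatS0_mulVec (v : Fin (n + 2) → ℚ) (i : Fin (n + 2)) :
    ((MatS0 n S).map (Int.cast : ℤ → ℝ) *ᵥ fun j => (v j : ℝ)) i =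
      (((MatS0 n S).map (Int.cast : ℤ → ℚ) *ᵥ v) i : ℚ) := by
  simp [Matrix.mulVec, dotProduct]

lemma ratCast_quadF_MatS0 (v : Fin (n + 2) → ℚ) :
    quadF ℝ (MatS0 n S) (fun j => (v j : ℝ)) = (quadF ℚ (MatS0 n S) v : ℚ) := by
  rw [quadF, quadF, bilin, bilin, dotProduct, dotProduct]
  simp only [ratCast_MatS0_mulVec]
  push_cast
  rfl

lemma ckS_mul_coneConst {M : Matrix (Fin n) (Fin n) ℝ} (hdet : M.det ≠ 0)
    (hM : |M.det| = Real.sqrt ((S.det : ℤ) : ℝ)) {k : ℕ} (hk : n + 1 < k) :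
    ckS n S k * (coneConst M ((k : ℝ) - (n + 2) / 2) k * ((2 * Real.pi) ^ 2)⁻¹ ^ k) = 1 := by
  have hk' : (n : ℝ) + 1 < k := by exact_mod_cast hk
  have hn : (0 : ℝ) ≤ n := n.cast_nonneg
  have h1 : Real.Gamma (k : ℝ) ≠ 0 := (Real.Gamma_pos_of_pos (by linarith)).ne'
  have h2 : Real.Gamma ((k : ℝ) - n / 2) ≠ 0 := (Real.Gamma_pos_of_pos (by linarith)).ne'
  have h3 : Real.sqrt ((S.det : ℤ) : ℝ) ≠ 0 := hM ▸ abs_ne_zero.2 hdet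
  have h4 : (0 : ℝ) < 2 * Real.pi := by positivity
  have h5 : (2 * Real.pi) ^ ((2 * k : ℝ) - n / 2) * (2 * Real.pi) ^ ((n : ℝ) / 2) =
      ((2 * Real.pi) ^ 2) ^ k := by
    rw [← Real.rpow_add h4, sub_add_cancel, ← pow_mul, ← Real.rpow_natCast]
    push_cast
    rfl
  have h6 : (k : ℝ) - (n + 2) / 2 + 1 = k - n / 2 := by ring
  rw [ckS, coneConst, hM, h6, inv_pow, ← h5]
  generalize Real.Gamma ((k : ℝ) - n / 2) = G at h2 ⊢
  have h7 : (2 * Real.pi) ^ ((2 * k : ℝ) - n / 2) ≠ 0 := (Real.rpow_pos_of_pos h4 _).ne'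
  have h8 : (2 * Real.pi) ^ ((n : ℝ) / 2) ≠ 0 := (Real.rpow_pos_of_pos h4 _).ne'
  field_simp

end DualLattice

/-- the periodized sum `Σ_{λ∈ℤ^{n+2}} (−Q₀(z+λ))^{−k}` equals
`c_{k,S}^• Σ_{λ∈L₀^#∩P_S} Q₀(λ)^{k−(n+2)/2} e^{2πi(λ,z)₀}`. -/
theorem quadratic_lattice_sum_fourier
    (n : ℕ) (hn : 1 ≤ n) (S : Matrix (Fin n) (Fin n) ℤ)
    (hsymm : S.IsSymm)
    (hpos : ∀ v : Fin n → ℝ, v ≠ 0 → 0 < bilin ℝ S v v)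
    (heven : ∀ v : Fin n → ℤ, 2 ∣ v ⬝ᵥ S.mulVec v)
    (k : ℕ) (hk : n + 1 < k)
    (z : Fin (n + 2) → ℂ) (hz : z ∈ HS n S) :
    Summable (fun lam : Fin (n + 2) → ℤ =>
      ‖(-(quadF ℂ (MatS0 n S) fun i => z i + (lam i : ℂ))) ^ (-(k : ℤ))‖) ∧
    Summable (fun lam : {lam : Fin (n + 2) → ℚ //
        inDual (MatS0 n S) lam ∧ (fun i => ((lam i : ℚ) : ℝ)) ∈ PosCone n S} =>
      ‖((((quadF ℚ (MatS0 n S) lam.1 : ℚ) : ℝ) ^ ((k : ℝ) - (n + 2) / 2) : ℝ) : ℂ) *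
        Complex.exp (2 * Real.pi * Complex.I *
          bilin ℂ (MatS0 n S) (fun i => ((lam.1 i : ℚ) : ℂ)) z)‖) ∧
    ∑' lam : Fin (n + 2) → ℤ,
      (-(quadF ℂ (MatS0 n S) fun i => z i + (lam i : ℂ))) ^ (-(k : ℤ))
    = ((ckS n S k : ℝ) : ℂ) *
      ∑' lam : {lam : Fin (n + 2) → ℚ //
          inDual (MatS0 n S) lam ∧ (fun i => ((lam i : ℚ) : ℝ)) ∈ PosCone n S},
        ((((quadF ℚ (MatS0 n S) lam.1 : ℚ) : ℝ) ^ ((k : ℝ) - (n + 2) / 2) : ℝ) : ℂ) *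
          Complex.exp (2 * Real.pi * Complex.I *
            bilin ℂ (MatS0 n S) (fun i => ((lam.1 i : ℚ) : ℂ)) z) := by
  classical
  obtain ⟨M, hM, hdet, hMabs⟩ := exists_mul_transpose_eq hsymm hpos
  have hT : InTube M z := inTube_of_mem_HS hM hz
  have hk' : (n : ℝ) + 1 < k := by exact_mod_cast hk
  have hσ : 0 ≤ (k : ℝ) - (n + 2) / 2 := by
    have : (0 : ℝ) ≤ n := n.cast_nonneg
    linarith
  have hterm : (fun lam : Fin (n + 2) → ℤ =>
      (-(quadF ℂ (MatS0 n S) fun i => z i + (lam i : ℂ))) ^ (-(k : ℤ))) =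
      (fun m : Fin (n + 2) → ℤ => (-tubeQuad M fun i => z i - m i) ^ (-(k : ℤ))) ∘
        Equiv.neg _ := by
    ext lam
    simp [tubeQuad_eq_quadF hM]
  choose j hj using fun lam : {lam : Fin (n + 2) → ℚ // inDual (MatS0 n S) lam ∧
    (fun i => ((lam i : ℚ) : ℝ)) ∈ PosCone n S} => lam.2.1
  have hjinj : Function.Injective j := fun a b hab => Subtype.ext <|
    MatS0_mulVec_injective hpos <| by ext i; rw [hj, hj, hab]
  have hcast : ∀ (m : Fin (n + 2) → ℤ) (lam : Fin (n + 2) → ℚ),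
      (∀ i, ((MatS0 n S).map (Int.cast : ℤ → ℚ) *ᵥ lam) i = m i) →
      (fun i => (m i : ℝ)) = (MatS0 n S).map (Int.cast : ℤ → ℝ) *ᵥ fun i => (lam i : ℝ) := by
    intro m lam h
    ext i
    rw [ratCast_MatS0_mulVec, h, Rat.cast_intCast]
  have hfun := coneFun_MatS0_mulVec hM hdet hsymm ((k : ℝ) - (n + 2) / 2) z
  set g : (Fin (n + 2) → ℤ) → ℂ :=
    fun m => coneFun M ((k : ℝ) - (n + 2) / 2) z fun i => (m i : ℝ) with hg
  have hgj : g ∘ j = fun lam =>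
      ((((quadF ℚ (MatS0 n S) lam.1 : ℚ) : ℝ) ^ ((k : ℝ) - (n + 2) / 2) : ℝ) : ℂ) *
        Complex.exp (2 * Real.pi * Complex.I *
          bilin ℂ (MatS0 n S) (fun i => ((lam.1 i : ℚ) : ℂ)) z) := by
    ext lam
    simp only [hg, Function.comp_apply]
    rw [hcast _ _ (hj lam), hfun, if_pos lam.2.2, ratCast_quadF_MatS0]
    simp only [Complex.ofReal_ratCast]
  have hsupp : Function.support g ⊆ Set.range j := by
    intro m hm
    obtain ⟨v, hv⟩ := exists_MatS0_mulVec_eq hpos fun i => (m i : ℚ)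
    have hv' := congrFun hv
    rw [Function.mem_support, hg] at hm
    simp only [hcast m v hv', hfun] at hm
    have hcone := of_not_not fun h => hm (if_neg h)
    refine ⟨⟨v, fun i => ⟨m i, hv' i⟩, hcone⟩, funext fun i => ?_⟩
    have h := hj ⟨v, fun i => ⟨m i, hv' i⟩, hcone⟩ i
    rw [hv'] at h
    exact_mod_cast h.symm
  obtain ⟨C, hC⟩ := exists_norm_coneFun_le hdet hσ hT
  have hsum : Summable fun m => ‖g m‖ := by
    simpa using summable_norm_lattice hC 0
  refine ⟨?_, ?_, ?_⟩
  · refine ((Equiv.neg _).summable_iff.2 (summable_norm_tubeQuad hdet hT hk)).congr fun lam => ?_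
    exact congrArg norm (congrFun hterm lam).symm
  · exact (hsum.comp_injective hjinj).congr fun lam => congrArg norm (congrFun hgj lam)
  · have h1 : tsum (g ∘ j) = tsum g := hjinj.tsum_eq hsupp
    have h2 := (Equiv.neg _).tsum_eq fun m : Fin (n + 2) → ℤ =>
      (-tubeQuad M fun i => z i - m i) ^ (-(k : ℤ))
    rw [← hgj, hterm, h1, hg, tsum_coneFun hdet hT hk, ← mul_assoc, ← Complex.ofReal_mul,
      ckS_mul_coneConst hdet hMabs hk, Complex.ofReal_one, one_mul]
    exact h2
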